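/- arXiv:2208.03810 — 3 statements merged into one kernel-verified Lean document; each statement's English description precedes it below -/
import Mathlib

section
/- There is a constant C > 0 such that for every integer n ≥ 2 and every monotone read-once DNF f : {0,1}^n → {0,1}, under unit costs and the uniform distribution there is a non-adaptive strategy S whose expected cost is at most C · log₂(n) · OPT_A(f); in particular OPT_N(f) ≤ C · log₂(n) · OPT_A(f). -/
open Finset

/-- The set of tested indices `T` determines `f` on input `x`:
every input agreeing with `x` on `T` gives the same function value. -/
def Determines (n : ℕ) (f : (Fin n → Bool) → Bool) (T : Finset (Fin n))
    (x : Fin n → Bool) : Prop :=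
  ∀ x' : Fin n → Bool, (∀ i ∈ T, x' i = x i) → f x' = f x

/-- The set of indices tested by the non-adaptive strategy `π` in its first `k` tests. -/
def prefixSet (n : ℕ) (π : Equiv.Perm (Fin n)) (k : ℕ) : Finset (Fin n) :=
  Finset.univ.filter (fun i => (π.symm i).val < k)

/-- The number of tests performed by the non-adaptive strategy `π` on input `x`:
the least `k` such that the first `k` tested indices determine `f` on `x`. -/
noncomputable def naSteps (n : ℕ) (f : (Fin n → Bool) → Bool)
    (π : Equiv.Perm (Fin n)) (x : Fin n → Bool) : ℕ :=
  sInf {k : ℕ | Determines n f (prefixSet n π k) x}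

/-- The cost incurred by the non-adaptive strategy `π` on input `x`, with cost vector `c`. -/
noncomputable def naCost (n : ℕ) (f : (Fin n → Bool) → Bool) (c : Fin n → ℝ)
    (π : Equiv.Perm (Fin n)) (x : Fin n → Bool) : ℝ :=
  ∑ i ∈ prefixSet n π (naSteps n f π x), c i

/-- Probability of the outcome `x` under the product distribution with parameters `p`. -/
def prodWeight (n : ℕ) (p : Fin n → ℝ) (x : Fin n → Bool) : ℝ :=
  ∏ i : Fin n, if x i then p i else 1 - p i

/-- Expected cost of the non-adaptive strategy `π`. -/
noncomputable def naExpCost (n : ℕ) (f : (Fin n → Bool) → Bool) (c : Fin n → ℝ)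
    (p : Fin n → ℝ) (π : Equiv.Perm (Fin n)) : ℝ :=
  ∑ x : Fin n → Bool, prodWeight n p x * naCost n f c π x

/-- Optimal expected cost among non-adaptive strategies. -/
noncomputable def OPTN (n : ℕ) (f : (Fin n → Bool) → Bool) (c : Fin n → ℝ)
    (p : Fin n → ℝ) : ℝ :=
  sInf { r : ℝ | ∃ π : Equiv.Perm (Fin n), r = naExpCost n f c p π }

/-- Binary decision trees over `n` variables (adaptive strategies). -/
inductive DecTree (n : ℕ) : Type
  | leaf : Bool → DecTree n
  | node : Fin n → DecTree n → DecTree n → DecTree n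

/-- Evaluation of a decision tree on an input. -/
def DecTree.eval {n : ℕ} : DecTree n → (Fin n → Bool) → Bool
  | .leaf b, _ => b
  | .node i t0 t1, x => if x i then DecTree.eval t1 x else DecTree.eval t0 x

/-- Cost of a decision tree on input `x`: the sum of the costs of the indices
labeling the internal nodes on the root-to-leaf path followed on `x`. -/
def DecTree.costOn {n : ℕ} (c : Fin n → ℝ) : DecTree n → (Fin n → Bool) → ℝ
  | .leaf _, _ => 0
  | .node i t0 t1, x =>
      c i + (if x i then DecTree.costOn c t1 x else DecTree.costOn c t0 x)

/-- The decision tree `t` computes the function `f`. -/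
def DecTree.Computes {n : ℕ} (t : DecTree n) (f : (Fin n → Bool) → Bool) : Prop :=
  ∀ x, t.eval x = f x

/-- Expected cost of an adaptive strategy (decision tree). -/
noncomputable def adExpCost (n : ℕ) (c : Fin n → ℝ) (p : Fin n → ℝ)
    (t : DecTree n) : ℝ :=
  ∑ x : Fin n → Bool, prodWeight n p x * DecTree.costOn c t x

/-- Optimal expected cost among adaptive strategies computing `f`. -/
noncomputable def OPTA (n : ℕ) (f : (Fin n → Bool) → Bool) (c : Fin n → ℝ)
    (p : Fin n → ℝ) : ℝ :=
  sInf { r : ℝ | ∃ t : DecTree n, DecTree.Computes t f ∧ r = adExpCost n c p t }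

/-- `f` is the monotone read-once DNF whose terms are the (nonempty, pairwise disjoint)
sets of variables `T 0, …, T (m-1)`. -/
def IsReadOnceDNF (n m : ℕ) (T : Fin m → Finset (Fin n))
    (f : (Fin n → Bool) → Bool) : Prop :=
  (∀ j, (T j).Nonempty) ∧
  (∀ j k, j ≠ k → Disjoint (T j) (T k)) ∧
  (∀ x, f x = true ↔ ∃ j, ∀ i ∈ T j, x i = true)


open Classical in
/-- Independence: restricting to the subcube where all of `S` is true. -/
theorem sum_sat (n : ℕ) (S : Finset (Fin n)) (h : (Fin n → Bool) → ℝ)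
    (hh : ∀ x y : Fin n → Bool, (∀ i, i ∉ S → x i = y i) → h x = h y) :
    ∑ x : Fin n → Bool, (if ∀ i ∈ S, x i = true then h x else 0)
      = (1/2 : ℝ) ^ S.card * ∑ x : Fin n → Bool, h x := by
  induction S using Finset.induction_on generalizing h with
  | empty => simp
  | insert a S ha ih =>
    have hS := ih h (fun x y hxy => hh x y (fun i hi => hxy i (by simp at hi; exact hi.2)))
    rw [Finset.card_insert_of_notMem ha, pow_succ]
    let F : (Fin n → Bool) → ℝ := fun x => if ∀ i ∈ S, x i = true then h x else 0
    have e1 : ∀ x : Fin n → Bool, (if ∀ i ∈ insert a S, x i = true then h x else 0)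
        = if x a = true then F x else 0 := by
      intro x
      simp only [F, Finset.forall_mem_insert]
      by_cases h1 : x a = true <;> simp [h1]
    have e2 : ∑ x : Fin n → Bool, (if x a = true then F x else 0)
        = ∑ x : Fin n → Bool, (if x a = true then 0 else F x) := by
      refine Finset.sum_bij' (fun x _ => Function.update x a (!x a))
        (fun x _ => Function.update x a (!x a)) (by simp) (by simp) (by simp) (by simp) ?_
      intro x _
      have hF : F (Function.update x a (!x a)) = F x := by
        simp only [F]
        have c1 : (∀ i ∈ S, Function.update x a (!x a) i = true) ↔ ∀ i ∈ S, x i = true := by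
          refine forall₂_congr fun i hi => ?_
          rw [Function.update_of_ne (by rintro rfl; exact ha hi)]
        have c2 : h (Function.update x a (!x a)) = h x := by
          apply hh
          intro i hi
          rw [Function.update_of_ne]
          rintro rfl
          simp at hi
        simp only [c1, c2]
      simp only [hF, Function.update_self]
      cases x a <;> simp
    have e3 : ∑ x : Fin n → Bool, (if x a = true then F x else 0)
        + ∑ x : Fin n → Bool, (if x a = true then 0 else F x) = ∑ x, F x := by
      rw [← Finset.sum_add_distrib]
      refine Finset.sum_congr rfl fun x _ => ?_
      split_ifs <;> simp
    simp only [e1]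
    have : ∑ x, F x = (1/2 : ℝ) ^ S.card * ∑ x : Fin n → Bool, h x := hS
    linarith

/-- Expected number of terms probed, in list order. -/
noncomputable def gcost {α : Type*} (q : α → ℝ) : List α → ℝ
  | [] => 0
  | j :: l => 1 + (1 - q j) * gcost q l

theorem gcost_nonneg {α : Type*} (q : α → ℝ) (h1 : ∀ j, q j ≤ 1) (l : List α) :
    0 ≤ gcost q l := by
  induction l with
  | nil => simp [gcost]
  | cons j l ih =>
    have := mul_nonneg (sub_nonneg.2 (h1 j)) ih
    simp only [gcost]; linarith

theorem gcost_erase {α : Type*} [DecidableEq α] (q : α → ℝ) (h1 : ∀ j, q j ≤ 1) (l : List α)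
    (hl : l.Pairwise (fun a b => q b ≤ q a)) (j : α) (hj : j ∈ l) :
    gcost q l ≤ 1 + (1 - q j) * gcost q (l.erase j) := by
  induction l with
  | nil => simp at hj
  | cons a l ih =>
    by_cases haj : a = j
    · subst haj; simp [gcost]
    · have hjl : j ∈ l := by
        rcases List.mem_cons.1 hj with h | h
        · exact absurd h.symm haj
        · exact h
      rw [List.erase_cons_tail (by simpa using haj)]
      rw [List.pairwise_cons] at hl
      have h2 := ih hl.2 hjl
      have h3 := hl.1 j hjl
      have h4 := mul_le_mul_of_nonneg_left h2 (sub_nonneg.2 (h1 a))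
      simp only [gcost]
      nlinarith

open Classical in
/-- Number of items probed in list order until one satisfies `s`. -/
noncomputable def ncount {α : Type*} (s : α → Prop) : List α → ℕ
  | [] => 0
  | j :: l => 1 + if s j then 0 else ncount s l

theorem ncount_spec {α : Type*} (s : α → Prop) (l : List α) :
    (∃ k, ∃ h : k < l.length, s l[k] ∧ k + 1 ≤ ncount s l) ∨
    ((∀ j ∈ l, ¬ s j) ∧ ncount s l = l.length) := by
  induction l with
  | nil => right; simp [ncount]
  | cons a l ih =>
    by_cases ha : s a
    · left; exact ⟨0, by simp, by simpa using ha, by simp [ncount, ha]⟩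
    · rcases ih with ⟨k, hk, h1, h2⟩ | ⟨h1, h2⟩
      · left
        exact ⟨k + 1, by simpa using hk, by simpa using h1, by simp [ncount, ha]; omega⟩
      · right
        refine ⟨by simpa [ha] using h1, by simp [ncount, ha, h2]; omega⟩

theorem ncount_congr {α : Type*} (s s' : α → Prop) (l : List α) (h : ∀ j ∈ l, (s j ↔ s' j)) :
    ncount s l = ncount s' l := by
  induction l with
  | nil => rfl
  | cons a l ih =>
    have := ih (fun j hj => h j (by simp [hj]))
    have h2 := h a (by simp)
    by_cases h3 : s' a <;> simp [ncount, this, h2, h3]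

/-- The term `S` is satisfied by `x`. -/
def Sat {n : ℕ} (S : Finset (Fin n)) (x : Fin n → Bool) : Prop := ∀ i ∈ S, x i = true

theorem Sat_congr {n : ℕ} (S : Finset (Fin n)) (x y : Fin n → Bool) (h : ∀ i ∈ S, x i = y i) :
    Sat S x ↔ Sat S y := by
  unfold Sat
  exact forall₂_congr fun i hi => by rw [h i hi]

open Classical in
theorem sum_not_sat (n : ℕ) (S : Finset (Fin n)) (h : (Fin n → Bool) → ℝ)
    (hh : ∀ x y : Fin n → Bool, (∀ i, i ∉ S → x i = y i) → h x = h y) :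
    ∑ x : Fin n → Bool, (if Sat S x then 0 else h x)
      = (1 - (1/2 : ℝ) ^ S.card) * ∑ x : Fin n → Bool, h x := by
  have := sum_sat n S h hh
  have e : ∑ x : Fin n → Bool, (if Sat S x then 0 else h x)
     + ∑ x : Fin n → Bool, (if ∀ i ∈ S, x i = true then h x else 0) = ∑ x, h x := by
    rw [← Finset.sum_add_distrib]
    refine Finset.sum_congr rfl fun x _ => ?_
    unfold Sat
    split_ifs <;> simp
  linarith

theorem sum_ncount (n m : ℕ) (T : Fin m → Finset (Fin n))
    (hd : ∀ j k, j ≠ k → Disjoint (T j) (T k)) (l : List (Fin m)) (hl : l.Nodup) :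
    ∑ x : Fin n → Bool, (ncount (fun j => Sat (T j) x) l : ℝ)
      = 2 ^ n * gcost (fun j => (1/2 : ℝ) ^ (T j).card) l := by
  classical
  induction l with
  | nil => simp [ncount, gcost]
  | cons a l ih =>
    rw [List.nodup_cons] at hl
    have h1 := sum_not_sat n (T a) (fun x => (ncount (fun j => Sat (T j) x) l : ℝ)) (by
      intro x y hxy
      congr 1
      apply ncount_congr
      intro j hj
      apply Sat_congr
      intro i hi
      apply hxy
      intro hia
      exact (Finset.disjoint_left.1 (hd a j (fun e => hl.1 (e ▸ hj)))) hia hi)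
    simp only [ncount, gcost, Nat.cast_add, Nat.cast_one]
    rw [Finset.sum_add_distrib]
    have : ∀ x : Fin n → Bool, (if Sat (T a) x then (0:ℝ) else (ncount (fun j => Sat (T j) x) l : ℝ))
      = ((if Sat (T a) x then 0 else ncount (fun j => Sat (T j) x) l : ℕ) : ℝ) := by
      intro x; split_ifs <;> simp
    rw [Finset.sum_congr rfl (fun x _ => (this x).symm), h1, ih hl.2]
    simp
    ring

open Classical in
theorem lower (n m : ℕ) (T : Fin m → Finset (Fin n)) (f : (Fin n → Bool) → Bool)
    (hT : IsReadOnceDNF n m T f) (t : DecTree n) :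
    ∀ l : List (Fin m),
      l.Pairwise (fun a b => (1/2 : ℝ) ^ (T b).card ≤ (1/2 : ℝ) ^ (T a).card) → l.Nodup →
      ∀ A : Finset (Fin n → Bool),
      (∀ x ∈ A, ∀ y : Fin n → Bool, (∀ i, (∀ j ∈ l, i ∉ T j) → y i = x i) → y ∈ A) →
      (∀ x ∈ A, t.eval x = f x) →
      gcost (fun j => (1/2 : ℝ) ^ (T j).card) l *
        ((A.filter (fun x => ∀ j, j ∉ l → ¬ Sat (T j) x)).card : ℝ)
        ≤ ∑ x ∈ A, DecTree.costOn (fun _ => (1:ℝ)) t x := by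
  obtain ⟨hne, hd, hf⟩ := hT
  have hq1 : ∀ j, (fun j => (1/2 : ℝ) ^ (T j).card) j ≤ 1 := fun j =>
    pow_le_one₀ (by norm_num) (by norm_num)
  induction t with
  | leaf b =>
    intro l hs hnd A hA hev
    simp only [DecTree.costOn, Finset.sum_const_zero]
    cases b with
    | true =>
      have : A.filter (fun x => ∀ j, j ∉ l → ¬ Sat (T j) x) = ∅ := by
        rw [Finset.filter_eq_empty_iff]
        intro x hx hns
        let y : Fin n → Bool := fun i => if ∀ j ∈ l, i ∉ T j then x i else false
        have hy : y ∈ A := hA x hx y (fun i hi => if_pos hi)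
        have hfy := hev y hy
        simp only [DecTree.eval] at hfy
        obtain ⟨j, hj⟩ := (hf y).1 hfy.symm
        by_cases hjl : j ∈ l
        · obtain ⟨i, hi⟩ := hne j
          have := hj i hi
          have h2 : ¬ ∀ j ∈ l, i ∉ T j := fun h => h j hjl hi
          simp [y, h2] at this
        · apply hns j hjl
          intro i hi
          have h1 := hj i hi
          by_contra h3
          simp only [y] at h1
          split_ifs at h1
          exact h3 h1
      simp [this]
    | false =>
      cases l with
      | nil => simp [gcost]
      | cons a l =>
        have : A = ∅ := by
          rw [Finset.eq_empty_iff_forall_notMem]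
          intro x hx
          let y : Fin n → Bool := fun i => if ∀ j ∈ a :: l, i ∉ T j then x i else true
          have hy : y ∈ A := hA x hx y (fun i hi => if_pos hi)
          have hfy := hev y hy
          simp only [DecTree.eval] at hfy
          have : f y = true := (hf y).2 ⟨a, fun i hi => if_neg (fun h => h a (by simp) hi)⟩
          rw [this] at hfy
          exact absurd hfy (by simp)
        simp [this]
  | node i t0 t1 ih0 ih1 =>
    intro l hs hnd A hA hev
    let A0 := A.filter (fun x => ¬ x i = true)
    let A1 := A.filter (fun x => x i = true)
    have hcost : ∑ x ∈ A, DecTree.costOn (fun _ => (1:ℝ)) (.node i t0 t1) x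
        = A.card + (∑ x ∈ A1, DecTree.costOn (fun _ => (1:ℝ)) t1 x
          + ∑ x ∈ A0, DecTree.costOn (fun _ => (1:ℝ)) t0 x) := by
      simp only [DecTree.costOn, Finset.sum_add_distrib, A0, A1]
      rw [Finset.sum_ite]
      simp
    have hev0 : ∀ x ∈ A0, t0.eval x = f x := by
      intro x hx
      obtain ⟨h1, h2⟩ := Finset.mem_filter.1 hx
      have := hev x h1
      simpa only [DecTree.eval, if_neg h2] using this
    have hev1 : ∀ x ∈ A1, t1.eval x = f x := by
      intro x hx
      obtain ⟨h1, h2⟩ := Finset.mem_filter.1 hx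
      have := hev x h1
      simpa only [DecTree.eval, if_pos h2] using this
    have key : ∀ l' : List (Fin m), l'.Sublist l → (∀ j ∈ l', i ∉ T j) →
        gcost (fun j => (1/2 : ℝ) ^ (T j).card) l' *
          ((A.filter (fun x => ∀ j, j ∉ l' → ¬ Sat (T j) x)).card : ℝ) + A.card
          ≤ ∑ x ∈ A, DecTree.costOn (fun _ => (1:ℝ)) (.node i t0 t1) x := by
      intro l' hsub hi
      have h0 := ih0 l' (hs.sublist hsub) (hnd.sublist hsub) A0 (by
        intro x hx y hxy
        obtain ⟨h1, h2⟩ := Finset.mem_filter.1 hx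
        refine Finset.mem_filter.2 ⟨hA x h1 y (fun k hk => hxy k (fun j hj =>
          hk j (hsub.subset hj))), ?_⟩
        rw [hxy i hi]; exact h2) hev0
      have h1 := ih1 l' (hs.sublist hsub) (hnd.sublist hsub) A1 (by
        intro x hx y hxy
        obtain ⟨h1, h2⟩ := Finset.mem_filter.1 hx
        refine Finset.mem_filter.2 ⟨hA x h1 y (fun k hk => hxy k (fun j hj =>
          hk j (hsub.subset hj))), ?_⟩
        rw [hxy i hi]; exact h2) hev1
      have hcard : ((A.filter (fun x => ∀ j, j ∉ l' → ¬ Sat (T j) x)).card : ℝ)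
          = ((A1.filter (fun x => ∀ j, j ∉ l' → ¬ Sat (T j) x)).card : ℝ)
           + ((A0.filter (fun x => ∀ j, j ∉ l' → ¬ Sat (T j) x)).card : ℝ) := by
        rw [← Nat.cast_add]
        congr 1
        rw [← Finset.card_filter_add_card_filter_not
          (s := A.filter (fun x => ∀ j, j ∉ l' → ¬ Sat (T j) x)) (fun x => x i = true)]
        simp only [A0, A1, Finset.filter_filter, and_comm]
      rw [hcost, hcard]
      linarith
    by_cases hi : ∃ j ∈ l, i ∈ T j
    · obtain ⟨j, hjl, hij⟩ := hi
      have hk := key (l.erase j) (List.erase_sublist) (by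
        intro k hk hik
        have hkj : k ≠ j := ((List.Nodup.mem_erase_iff hnd).1 hk).1
        exact Finset.disjoint_left.1 (hd k j hkj) hik hij)
      have hg := gcost_erase (fun j => (1/2 : ℝ) ^ (T j).card) hq1 l hs j hjl
      let P : (Fin n → Bool) → Prop := fun x => x ∈ A ∧ ∀ j, j ∉ l → ¬ Sat (T j) x
      have hPinv : ∀ x y : Fin n → Bool, (∀ i, i ∉ T j → x i = y i) → P x → P y := by
        intro x y hxy hP
        refine ⟨hA x hP.1 y (fun k hk => (hxy k (hk j hjl)).symm), ?_⟩
        intro k hk hsat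
        apply hP.2 k hk
        rw [Sat_congr (T k) x y]
        · exact hsat
        · intro i' hi'
          apply hxy
          intro h'
          exact Finset.disjoint_left.1 (hd k j (fun e => hk (e ▸ hjl))) hi' h'
      have hsum := sum_not_sat n (T j) (fun x => if P x then (1:ℝ) else 0) (by
        intro x y hxy
        have : P x ↔ P y := ⟨hPinv x y hxy, hPinv y x (fun i hi => (hxy i hi).symm)⟩
        simp only [this])
      have c1 : ∑ x : Fin n → Bool, (if P x then (1:ℝ) else 0)
          = ((A.filter (fun x => ∀ j, j ∉ l → ¬ Sat (T j) x)).card : ℝ) := by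
        rw [Finset.sum_boole]
        congr 2
        ext x; simp [P]
      have c2 : ∑ x : Fin n → Bool, (if Sat (T j) x then 0 else if P x then (1:ℝ) else 0)
          = ((A.filter (fun x => ∀ k, k ∉ l.erase j → ¬ Sat (T k) x)).card : ℝ) := by
        have : ∀ x : Fin n → Bool, (if Sat (T j) x then 0 else if P x then (1:ℝ) else 0)
          = if (¬ Sat (T j) x ∧ P x) then 1 else 0 := by
          intro x; by_cases h : Sat (T j) x <;> simp [h]
        simp only [this]
        rw [Finset.sum_boole]
        congr 2
        ext x
        simp only [P, Finset.mem_filter, Finset.mem_univ, true_and]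
        constructor
        · rintro ⟨h1, h2, h3⟩
          refine ⟨h2, fun k hk => ?_⟩
          by_cases hkj : k = j
          · rw [hkj]; exact h1
          · exact h3 k (fun hkl => hk ((List.Nodup.mem_erase_iff hnd).2 ⟨hkj, hkl⟩))
        · rintro ⟨h1, h2⟩
          refine ⟨h2 j (fun h => ((List.Nodup.mem_erase_iff hnd).1 h).1 rfl), h1, fun k hk => ?_⟩
          exact h2 k (fun h => hk (List.mem_of_mem_erase h))
      rw [c1, c2] at hsum
      have hBA : ((A.filter (fun x => ∀ j, j ∉ l → ¬ Sat (T j) x)).card : ℝ) ≤ A.card := by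
        exact_mod_cast Finset.card_filter_le _ _
      have hB0 : (0:ℝ) ≤ ((A.filter (fun x => ∀ j, j ∉ l → ¬ Sat (T j) x)).card : ℝ) :=
        Nat.cast_nonneg _
      have := mul_le_mul_of_nonneg_right hg hB0
      rw [hsum] at hk
      linarith
    · push Not at hi
      have := key l (List.Sublist.refl l) hi
      have h0 : (0:ℝ) ≤ A.card := Nat.cast_nonneg _
      linarith

/-- Complete decision tree. -/
def buildTree {n : ℕ} (f : (Fin n → Bool) → Bool) : List (Fin n) → (Fin n → Bool) → DecTree n
  | [], x => .leaf (f x)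
  | i :: v, x => .node i (buildTree f v (Function.update x i false))
      (buildTree f v (Function.update x i true))

theorem buildTree_eval {n : ℕ} (f : (Fin n → Bool) → Bool) (v : List (Fin n))
    (x y : Fin n → Bool) (h : ∀ i, i ∉ v → x i = y i) : (buildTree f v x).eval y = f y := by
  induction v generalizing x with
  | nil =>
    have : x = y := funext fun i => h i (by simp)
    simp [buildTree, DecTree.eval, this]
  | cons a v ih =>
    have hb : ∀ b, y a = b → ∀ i, i ∉ v → Function.update x a b i = y i := by
      intro b hb i hi
      by_cases hia : i = a
      · subst hia; simp [hb]
      · rw [Function.update_of_ne hia]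
        exact h i (by simp [hia, hi])
    simp only [buildTree, DecTree.eval]
    cases hya : y a with
    | true => simpa using ih _ (hb true hya)
    | false => simpa using ih _ (hb false hya)

theorem prodWeight_half (n : ℕ) (x : Fin n → Bool) :
    prodWeight n (fun _ => 1/2) x = (1/2 : ℝ) ^ n := by
  unfold prodWeight
  have : ∀ i : Fin n, (if x i = true then (1/2:ℝ) else 1 - 1/2) = 1/2 := by
    intro i; split_ifs <;> norm_num
  simp only [this]
  simp

theorem exists_perm_key (n : ℕ) (key : Fin n → ℕ) : ∃ π : Equiv.Perm (Fin n),
    ∀ p, Finset.univ.filter (fun i => key i < p)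
      ⊆ prefixSet n π (Finset.univ.filter (fun i => key i < p)).card := by
  refine ⟨Tuple.sort key, fun p i hi => ?_⟩
  have hm := Tuple.monotone_sort key
  set π := Tuple.sort key
  have hi' : key i < p := (Finset.mem_filter.1 hi).2
  simp only [prefixSet, Finset.mem_filter, Finset.mem_univ, true_and]
  have h1 : (Finset.univ.filter (fun k : Fin n => k ≤ π.symm i)).image π
      ⊆ Finset.univ.filter (fun i => key i < p) := by
    intro k hk
    obtain ⟨k', hk', rfl⟩ := Finset.mem_image.1 hk
    have := hm (Finset.mem_filter.1 hk').2
    simp only [Function.comp, Equiv.apply_symm_apply] at this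
    exact Finset.mem_filter.2 ⟨Finset.mem_univ _, lt_of_le_of_lt this hi'⟩
  have h2 := Finset.card_le_card h1
  rw [Finset.card_image_of_injective _ π.injective] at h2
  have h3 : (Finset.univ.filter (fun k : Fin n => k ≤ π.symm i)).card = (π.symm i).val + 1 := by
    have : Finset.univ.filter (fun k : Fin n => k ≤ π.symm i) = Finset.Iic (π.symm i) := by
      ext; simp
    rw [this, Fin.card_Iic]
  omega

theorem prefixSet_card_le (n : ℕ) (π : Equiv.Perm (Fin n)) (k : ℕ) :
    (prefixSet n π k).card ≤ k := by
  have : (prefixSet n π k).card ≤ (Finset.range k).card := by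
    refine Finset.card_le_card_of_injOn (fun i => (π.symm i).val) ?_ ?_
    · intro i hi
      have := (Finset.mem_filter.1 hi).2
      simpa using this
    · intro a _ b _ hab
      exact π.symm.injective (Fin.val_injective hab)
  simpa using this

theorem naCost_le (n : ℕ) (f : (Fin n → Bool) → Bool) (π : Equiv.Perm (Fin n))
    (x : Fin n → Bool) (S : Finset (Fin n)) (hS : S ⊆ prefixSet n π S.card)
    (hdet : Determines n f S x) : naCost n f (fun _ => 1) π x ≤ S.card := by
  have h1 : naSteps n f π x ≤ S.card :=
    Nat.sInf_le (fun x' hx' => hdet x' (fun i hi => hx' i (hS hi)))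
  have h2 := prefixSet_card_le n π (naSteps n f π x)
  unfold naCost
  simp only [Finset.sum_const, nsmul_eq_mul, mul_one]
  exact_mod_cast h2.trans h1

theorem naCost_le_n (n : ℕ) (f : (Fin n → Bool) → Bool) (π : Equiv.Perm (Fin n))
    (x : Fin n → Bool) : naCost n f (fun _ => 1) π x ≤ n := by
  unfold naCost
  simp only [Finset.sum_const, nsmul_eq_mul, mul_one]
  have := Finset.card_le_univ (prefixSet n π (naSteps n f π x))
  simp only [Fintype.card_fin] at this
  exact_mod_cast this

open Classical in
theorem upper (n m K : ℕ) (T : Fin m → Finset (Fin n)) (f : (Fin n → Bool) → Bool)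
    (hT : IsReadOnceDNF n m T f) :
    ∃ π : Equiv.Perm (Fin n), naExpCost n f (fun _ => 1) (fun _ => 1/2) π
      ≤ K * gcost (fun j => (1/2 : ℝ) ^ (T j).card) (List.finRange m)
        + n * (m * (1/2 : ℝ) ^ K) := by
  obtain ⟨hne, hd, hf⟩ := hT
  have hT' : ∀ j, ∃ S ⊆ T j, S.card ≤ K ∧ (S = T j ∨ S.card = K) := by
    intro j
    by_cases h : (T j).card ≤ K
    · exact ⟨T j, le_rfl, h, Or.inl rfl⟩
    · obtain ⟨S, h1, h2⟩ := Finset.exists_subset_card_eq (le_of_not_ge h)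
      exact ⟨S, h1, h2.le, Or.inr h2⟩
  choose T' hsub hcard hor using hT'
  let key : Fin n → ℕ := fun i => if h : ∃ j, i ∈ T' j then (Classical.choose h).val else m
  have hkey : ∀ j, ∀ i ∈ T' j, key i = j.val := by
    intro j i hi
    have h : ∃ j, i ∈ T' j := ⟨j, hi⟩
    have h2 := Classical.choose_spec h
    simp only [key, dif_pos h]
    by_contra hne'
    have : Classical.choose h ≠ j := fun e => hne' (by rw [e])
    exact Finset.disjoint_left.1 (hd _ j this) (hsub _ h2) (hsub _ hi)
  have hkc : ∀ p, p ≤ m → (Finset.univ.filter (fun i => key i < p)).card ≤ K * p := by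
    intro p hp
    have h1 : Finset.univ.filter (fun i => key i < p)
        ⊆ (Finset.univ.filter (fun j : Fin m => j.val < p)).biUnion T' := by
      intro i hi
      have hi' := (Finset.mem_filter.1 hi).2
      by_cases h : ∃ j, i ∈ T' j
      · obtain ⟨j, hj⟩ := h
        rw [hkey j i hj] at hi'
        exact Finset.mem_biUnion.2 ⟨j, by simpa using hi', hj⟩
      · simp only [key, dif_neg h] at hi'
        omega
    have h2 := Finset.card_biUnion_le_card_mul
      (Finset.univ.filter (fun j : Fin m => j.val < p)) T' K (fun j _ => hcard j)
    have h3 : (Finset.univ.filter (fun j : Fin m => j.val < p)).card ≤ p := by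
      have := prefixSet_card_le m (Equiv.refl _) p
      unfold prefixSet at this
      convert this using 2
      ext a
      rw [Finset.mem_filter, Finset.mem_filter]
      rfl
    calc _ ≤ _ := Finset.card_le_card h1
      _ ≤ _ := h2
      _ ≤ p * K := Nat.mul_le_mul_right _ h3
      _ = K * p := Nat.mul_comm _ _
  obtain ⟨π, hπ⟩ := exists_perm_key n key
  refine ⟨π, ?_⟩
  have hpt : ∀ x : Fin n → Bool, naCost n f (fun _ => 1) π x ≤
      K * (ncount (fun j => Sat (T j) x) (List.finRange m) : ℝ)
      + n * ∑ j : Fin m, (if (T' j).card = K then (if ∀ i ∈ T' j, x i = true then (1:ℝ) else 0)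
          else 0) := by
    intro x
    have hs0 : ∀ j, (0:ℝ) ≤ (if (T' j).card = K then
        (if ∀ i ∈ T' j, x i = true then (1:ℝ) else 0) else 0) := by
      intro j; split_ifs <;> norm_num
    by_cases hE : ∃ j, (T' j).card = K ∧ ∀ i ∈ T' j, x i = true
    · obtain ⟨j, hj1, hj2⟩ := hE
      have h1 := naCost_le_n n f π x
      have h2 := Finset.single_le_sum (f := fun j => (if (T' j).card = K then
        (if ∀ i ∈ T' j, x i = true then (1:ℝ) else 0) else 0)) (fun j _ => hs0 j)
        (Finset.mem_univ j)
      simp only [if_pos hj1, if_pos hj2] at h2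
      have h3 : (0:ℝ) ≤ n := Nat.cast_nonneg _
      have h4 : (0:ℝ) ≤ K * (ncount (fun j => Sat (T j) x) (List.finRange m) : ℝ) := by positivity
      nlinarith
    · have hsum : (0:ℝ) ≤ n * ∑ j : Fin m, (if (T' j).card = K then
        (if ∀ i ∈ T' j, x i = true then (1:ℝ) else 0) else 0) :=
        mul_nonneg (Nat.cast_nonneg _) (Finset.sum_nonneg fun j _ => hs0 j)
      have hmain : ∀ p, p ≤ m → p ≤ ncount (fun j => Sat (T j) x) (List.finRange m) →
          Determines n f (Finset.univ.filter (fun i => key i < p)) x →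
          naCost n f (fun _ => 1) π x ≤
            K * (ncount (fun j => Sat (T j) x) (List.finRange m) : ℝ) := by
        intro p hp hpN hdet
        have h1 := naCost_le n f π x _ (hπ p) hdet
        have h2 : (Finset.univ.filter (fun i => key i < p)).card ≤
          K * ncount (fun j => Sat (T j) x) (List.finRange m) :=
          (hkc p hp).trans (Nat.mul_le_mul_left _ hpN)
        refine h1.trans ?_
        exact_mod_cast h2
      refine le_add_of_le_of_nonneg ?_ hsum
      rcases ncount_spec (fun j => Sat (T j) x) (List.finRange m) with ⟨k, hk, h1, h2⟩ | ⟨h1, h2⟩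
      · have hkm : k < m := by simpa using hk
        refine hmain (k+1) hkm h2 ?_
        have h1 : Sat (T ⟨k, hkm⟩) x := by simpa using h1
        have hTT : T' ⟨k, hkm⟩ = T ⟨k, hkm⟩ := by
          rcases hor ⟨k, hkm⟩ with h | h
          · exact h
          · exact absurd ⟨⟨k, hkm⟩, h, fun i hi => h1 i (hsub _ hi)⟩ hE
        intro y hy
        rw [(hf x).2 ⟨⟨k, hkm⟩, h1⟩, (hf y).2]
        refine ⟨⟨k, hkm⟩, fun i hi => ?_⟩
        rw [hy i, h1 i hi]
        simp only [Finset.mem_filter, Finset.mem_univ, true_and]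
        rw [hkey ⟨k, hkm⟩ i (hTT ▸ hi)]
        simp
      · refine hmain m le_rfl (by simp [h2]) ?_
        have hzero : ∀ j, ∃ i ∈ T' j, ¬ x i = true := by
          intro j
          by_contra hcon
          push Not at hcon
          rcases hor j with h | h
          · exact h1 j (by simp) (h ▸ hcon)
          · exact hE ⟨j, h, hcon⟩
        intro y hy
        have hfx : ∀ z : Fin n → Bool,
            (∀ i ∈ Finset.univ.filter (fun i => key i < m), z i = x i) → f z = false := by
          intro z hz
          rw [Bool.eq_false_iff]
          intro hfz
          obtain ⟨j, hj⟩ := (hf z).1 hfz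
          obtain ⟨i, hi, hxi⟩ := hzero j
          apply hxi
          rw [← hz i]
          · exact hj i (hsub _ hi)
          · simp only [Finset.mem_filter, Finset.mem_univ, true_and]
            rw [hkey j i hi]; exact j.2
        rw [hfx y hy, hfx x (fun _ _ => rfl)]
  have hE : ∑ x : Fin n → Bool, ∑ j : Fin m, (if (T' j).card = K then
      (if ∀ i ∈ T' j, x i = true then (1:ℝ) else 0) else 0) ≤ m * (1/2 : ℝ) ^ K * 2 ^ n := by
    rw [Finset.sum_comm]
    have : ∀ j ∈ (Finset.univ : Finset (Fin m)), ∑ x : Fin n → Bool, (if (T' j).card = K then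
      (if ∀ i ∈ T' j, x i = true then (1:ℝ) else 0) else 0) ≤ (1/2 : ℝ) ^ K * 2 ^ n := by
      intro j _
      by_cases h : (T' j).card = K
      · simp only [if_pos h]
        rw [sum_sat n (T' j) (fun _ => 1) (fun _ _ _ => rfl), h]
        simp
      · simp only [if_neg h, Finset.sum_const_zero]
        positivity
    refine (Finset.sum_le_sum this).trans ?_
    simp [mul_assoc]
  have hN := sum_ncount n m T hd (List.finRange m) (List.nodup_finRange m)
  unfold naExpCost
  simp only [prodWeight_half]
  rw [← Finset.mul_sum]
  have hS := Finset.sum_le_sum (fun x (_ : x ∈ Finset.univ) => hpt x)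
  rw [Finset.sum_add_distrib, ← Finset.mul_sum, ← Finset.mul_sum, hN] at hS
  have hn0 : (0:ℝ) ≤ n := Nat.cast_nonneg _
  have h5 := mul_le_mul_of_nonneg_left hE hn0
  have h6 : (1/2 : ℝ) ^ n * 2 ^ n = 1 := by rw [← mul_pow]; norm_num
  calc _ ≤ (1/2 : ℝ) ^ n * (K * (2 ^ n * gcost (fun j => (1/2 : ℝ) ^ (T j).card) (List.finRange m))
        + n * (m * (1/2 : ℝ) ^ K * 2 ^ n)) := by
        apply mul_le_mul_of_nonneg_left _ (by positivity)
        linarith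
    _ = ((1/2 : ℝ) ^ n * 2 ^ n) * (K * gcost (fun j => (1/2 : ℝ) ^ (T j).card) (List.finRange m)
        + n * (m * (1/2 : ℝ) ^ K)) := by ring
    _ = _ := by rw [h6, one_mul]

theorem exists_sorted (n m : ℕ) (T : Fin m → Finset (Fin n)) (f : (Fin n → Bool) → Bool)
    (hT : IsReadOnceDNF n m T f) : ∃ T₂ : Fin m → Finset (Fin n), IsReadOnceDNF n m T₂ f ∧
      Monotone (fun j => (T₂ j).card) := by
  obtain ⟨hne, hd, hf⟩ := hT
  let σ := Tuple.sort (fun j => (T j).card)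
  refine ⟨fun j => T (σ j), ⟨fun j => hne _, fun j k hjk => hd _ _ (σ.injective.ne hjk), ?_⟩,
    Tuple.monotone_sort (fun j => (T j).card)⟩
  intro x
  rw [hf x]
  constructor
  · rintro ⟨j, hj⟩
    exact ⟨σ.symm j, by simpa using hj⟩
  · rintro ⟨j, hj⟩
    exact ⟨_, hj⟩

theorem opta_ge (n m : ℕ) (T : Fin m → Finset (Fin n)) (f : (Fin n → Bool) → Bool)
    (hT : IsReadOnceDNF n m T f) (hmono : Monotone (fun j => (T j).card)) :
    gcost (fun j => (1/2 : ℝ) ^ (T j).card) (List.finRange m)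
      ≤ OPTA n f (fun _ => 1) (fun _ => 1/2) := by
  classical
  apply le_csInf
  · exact ⟨_, buildTree f (List.finRange n) (fun _ => false),
      fun x => buildTree_eval f _ _ _ (by simp), rfl⟩
  · rintro r ⟨t, ht, rfl⟩
    have h := lower n m T f hT t (List.finRange m) (by
      refine (List.pairwise_lt_finRange m).imp ?_
      intro a b hab
      exact pow_le_pow_of_le_one (by norm_num) (by norm_num) (hmono hab.le))
      (List.nodup_finRange m) Finset.univ (by simp) (fun x _ => ht x)
    simp only [List.mem_finRange, not_true_eq_false, false_implies, implies_true,
      Finset.filter_true, Finset.card_univ, Fintype.card_pi, Fintype.card_bool,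
      Finset.prod_const, Fintype.card_fin] at h
    push_cast at h
    unfold adExpCost
    simp only [prodWeight_half]
    rw [← Finset.mul_sum]
    have h6 : (1/2 : ℝ) ^ n * 2 ^ n = 1 := by rw [← mul_pow]; norm_num
    have := mul_le_mul_of_nonneg_left h (by positivity : (0:ℝ) ≤ (1/2 : ℝ) ^ n)
    calc gcost (fun j => (1/2 : ℝ) ^ (T j).card) (List.finRange m)
        = ((1/2 : ℝ) ^ n * 2 ^ n) * gcost (fun j => (1/2 : ℝ) ^ (T j).card) (List.finRange m) := by
          rw [h6, one_mul]
      _ = (1/2 : ℝ) ^ n * (gcost (fun j => (1/2 : ℝ) ^ (T j).card) (List.finRange m) * 2 ^ n) := by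
          ring
      _ ≤ _ := this

theorem main_bound (n : ℕ) (hn : 2 ≤ n) (f : (Fin n → Bool) → Bool)
    (h : ∃ (m : ℕ) (T : Fin m → Finset (Fin n)), IsReadOnceDNF n m T f) :
    ∃ π : Equiv.Perm (Fin n),
              naExpCost n f (fun _ => 1) (fun _ => 1/2) π ≤
                5 * Real.logb 2 n * OPTA n f (fun _ => 1) (fun _ => 1/2) := by
  obtain ⟨m, T₀, hT₀⟩ := h
  obtain ⟨T, hT, hmono⟩ := exists_sorted n m T₀ f hT₀
  obtain ⟨π, hπ⟩ := upper n m (2 * Nat.clog 2 n) T f hT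
  refine ⟨π, hπ.trans ?_⟩
  have hA := opta_ge n m T f hT hmono
  have hg0 := gcost_nonneg (fun j => (1/2 : ℝ) ^ (T j).card)
    (fun j => pow_le_one₀ (by norm_num) (by norm_num)) (List.finRange m)
  set g := gcost (fun j => (1/2 : ℝ) ^ (T j).card) (List.finRange m) with hg
  have hnpos : (0:ℝ) < n := by positivity
  have hlog1 : 1 ≤ Real.logb 2 n := by
    rw [Real.le_logb_iff_rpow_le (by norm_num) hnpos]
    simpa using (by exact_mod_cast hn : (2:ℝ) ≤ n)
  have hclog : (Nat.clog 2 n : ℝ) ≤ Real.logb 2 n + 1 := by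
    rw [← Real.natCeil_logb_natCast]
    have := (Nat.ceil_lt_add_one (show (0:ℝ) ≤ Real.logb (2:ℕ) n by push_cast; linarith)).le
    push_cast at this ⊢
    exact this
  have hmn : m ≤ n := by
    choose c hc using hT.1
    have : Function.Injective c := by
      intro a b hab
      by_contra hne
      exact Finset.disjoint_left.1 (hT.2.1 a b hne) (hc a) (hab ▸ hc b)
    simpa using Fintype.card_le_of_injective c this
  have hK : (n:ℝ) ^ 2 * (1/2 : ℝ) ^ (2 * Nat.clog 2 n) ≤ 1 := by
    have h1 : (n:ℝ) ≤ 2 ^ (Nat.clog 2 n) := by exact_mod_cast Nat.le_pow_clog (by norm_num) n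
    rw [mul_comm 2, pow_mul, ← mul_pow]
    have h2 : (n:ℝ) * (1/2 : ℝ) ^ (Nat.clog 2 n) ≤ 1 := by
      rw [one_div, inv_pow, ← div_eq_mul_inv, div_le_one (by positivity)]
      exact h1
    exact pow_le_one₀ (by positivity) h2
  have hX : (n:ℝ) * (m * (1/2 : ℝ) ^ (2 * Nat.clog 2 n)) ≤ g := by
    rcases Nat.eq_zero_or_pos m with hm | hm
    · rw [hm]; simpa using hg0
    · have hg1 : 1 ≤ g := by
        obtain ⟨m', rfl⟩ : ∃ m', m = m' + 1 := ⟨m - 1, by omega⟩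
        rw [hg, List.finRange_succ]
        simp only [gcost]
        have := gcost_nonneg (fun j => (1/2 : ℝ) ^ (T j).card)
          (fun j => pow_le_one₀ (by norm_num) (by norm_num)) ((List.finRange m').map Fin.succ)
        have h3 : (0:ℝ) ≤ 1 - (1/2 : ℝ) ^ (T 0).card :=
          sub_nonneg.2 (pow_le_one₀ (by norm_num) (by norm_num))
        have := mul_nonneg h3 this
        linarith
      have hmn' : (m:ℝ) ≤ n := by exact_mod_cast hmn
      have : (n:ℝ) * (m * (1/2 : ℝ) ^ (2 * Nat.clog 2 n))
          ≤ (n:ℝ) * (n * (1/2 : ℝ) ^ (2 * Nat.clog 2 n)) := by gcongr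
      nlinarith
  push_cast
  calc _ ≤ 2 * (Nat.clog 2 n : ℝ) * g + g := by linarith
    _ ≤ 2 * (Real.logb 2 n + 1) * g + g := by gcongr
    _ = (2 * Real.logb 2 n + 3) * g := by ring
    _ ≤ (5 * Real.logb 2 n) * g := by
        apply mul_le_mul_of_nonneg_right _ hg0
        linarith
    _ ≤ _ := by
        apply mul_le_mul_of_nonneg_left hA
        linarith

/-- There is a constant `C > 0` such that for every `n ≥ 2` and every monotone read-once
DNF `f` on `n` variables, under unit costs and the uniform distribution there is a
non-adaptive strategy of expected cost at most `C·log₂ n · OPT_A(f)`; in particular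
`OPT_N(f) ≤ C·log₂ n · OPT_A(f)`. -/
theorem stmt0 :
    ∃ C : ℝ, 0 < C ∧
      ∀ n : ℕ, 2 ≤ n →
        ∀ f : (Fin n → Bool) → Bool,
          (∃ (m : ℕ) (T : Fin m → Finset (Fin n)), IsReadOnceDNF n m T f) →
          (∃ π : Equiv.Perm (Fin n),
              naExpCost n f (fun _ => 1) (fun _ => 1/2) π ≤
                C * Real.logb 2 n * OPTA n f (fun _ => 1) (fun _ => 1/2)) ∧
          OPTN n f (fun _ => 1) (fun _ => 1/2) ≤
            C * Real.logb 2 n * OPTA n f (fun _ => 1) (fun _ => 1/2) := by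
  refine ⟨5, by norm_num, fun n hn f h => ?_⟩
  obtain ⟨π, hπ⟩ := main_bound n hn f h
  refine ⟨⟨π, hπ⟩, le_trans (csInf_le ?_ ⟨π, rfl⟩) hπ⟩
  refine ⟨0, ?_⟩
  rintro r ⟨π', rfl⟩
  unfold naExpCost
  refine Finset.sum_nonneg fun x _ => mul_nonneg ?_ ?_
  · rw [prodWeight_half]; positivity
  · unfold naCost
    exact Finset.sum_nonneg fun _ _ => zero_le_one
end

section
/- There is a constant c > 0 such that for every integer m ≥ 4, letting n = m² and letting f : {0,1}^n → {0,1} be the monotone read-once DNF consisting of m pairwise-disjoint terms of m variables each (so all n variables appear), under unit costs and the uniform distribution OPT_N(f) ≥ c · log₂(n) · OPT_A(f). -/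
open Finset

/-- Expectation under the uniform distribution. -/
noncomputable def EE (n : ℕ) (g : (Fin n → Bool) → ℝ) : ℝ :=
  ∑ x : Fin n → Bool, prodWeight n (fun _ => 1/2) x * g x

/-- Indicator that all coordinates in `S` are one. -/
noncomputable def ones {n : ℕ} (S : Finset (Fin n)) (x : Fin n → Bool) : ℝ :=
  ∏ i ∈ S, if x i then 1 else 0

lemma pw_nonneg (n : ℕ) (x : Fin n → Bool) : 0 ≤ prodWeight n (fun _ => 1/2) x := by
  unfold prodWeight
  apply Finset.prod_nonneg
  intro i _
  split_ifs <;> norm_num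

lemma EE_mono {n : ℕ} {g h : (Fin n → Bool) → ℝ} (H : ∀ x, g x ≤ h x) : EE n g ≤ EE n h := by
  unfold EE
  exact Finset.sum_le_sum fun x _ => mul_le_mul_of_nonneg_left (H x) (pw_nonneg n x)

lemma EE_add {n : ℕ} (g h : (Fin n → Bool) → ℝ) :
    EE n (fun x => g x + h x) = EE n g + EE n h := by
  simp [EE, mul_add, Finset.sum_add_distrib]

lemma EE_sub {n : ℕ} (g h : (Fin n → Bool) → ℝ) :
    EE n (fun x => g x - h x) = EE n g - EE n h := by
  simp [EE, mul_sub, Finset.sum_sub_distrib]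

lemma EE_mul {n : ℕ} (a : ℝ) (g : (Fin n → Bool) → ℝ) :
    EE n (fun x => a * g x) = a * EE n g := by
  simp only [EE, Finset.mul_sum]
  exact Finset.sum_congr rfl fun x _ => by ring

lemma EE_sum {n : ℕ} {ι : Type*} (J : Finset ι) (g : ι → (Fin n → Bool) → ℝ) :
    EE n (fun x => ∑ j ∈ J, g j x) = ∑ j ∈ J, EE n (g j) := by
  simp only [EE, Finset.mul_sum]
  exact Finset.sum_comm

lemma EE_ones {n : ℕ} (S : Finset (Fin n)) : EE n (ones S) = (1/2)^S.card := by
  unfold EE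
  have h : ∀ x : Fin n → Bool, prodWeight n (fun _ => 1/2) x * ones S x =
      ∏ i, (if i ∈ S then (if x i then (1/2:ℝ) else 0) else 1/2) := by
    intro x
    have : ones S x = ∏ i, (if i ∈ S then (if x i then (1:ℝ) else 0) else 1) := by
      unfold ones
      rw [Finset.prod_ite_mem]
      simp
    rw [this, prodWeight, ← Finset.prod_mul_distrib]
    apply Finset.prod_congr rfl
    intro i _
    split_ifs <;> norm_num
  simp_rw [h]
  have h2 := Finset.prod_univ_sum (fun _ : Fin n => (Finset.univ : Finset Bool))
    (fun i b => if i ∈ S then (if b then (1/2:ℝ) else 0) else 1/2)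
  rw [Fintype.piFinset_univ] at h2
  rw [← h2]
  have h3 : ∀ i : Fin n, (∑ b : Bool, if i ∈ S then (if b then (1/2:ℝ) else 0) else 1/2)
      = if i ∈ S then 1/2 else 1 := by
    intro i
    split_ifs <;> simp
  simp_rw [h3]
  rw [Finset.prod_ite_mem]
  simp

lemma EE_one (n : ℕ) : EE n (fun _ => 1) = 1 := by
  have := EE_ones (∅ : Finset (Fin n))
  simpa [ones, EE] using this

lemma ones_union {n : ℕ} {S R : Finset (Fin n)} (h : Disjoint S R) (x : Fin n → Bool) :
    ones (S ∪ R) x = ones S x * ones R x := Finset.prod_union h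

lemma ones_eq {n : ℕ} (S : Finset (Fin n)) (x : Fin n → Bool) :
    ones S x = if ∀ i ∈ S, x i = true then 1 else 0 := by
  unfold ones
  split_ifs with h
  · exact Finset.prod_eq_one fun i hi => by simp [h i hi]
  · push Not at h
    obtain ⟨i, hi, hx⟩ := h
    exact Finset.prod_eq_zero hi (by simp [hx])

lemma EE_prod {n : ℕ} {ι : Type*} [DecidableEq ι] (R : ι → Finset (Fin n)) (J : Finset ι) :
    (∀ j ∈ J, ∀ k ∈ J, j ≠ k → Disjoint (R j) (R k)) →
    ∀ S : Finset (Fin n), (∀ j ∈ J, Disjoint S (R j)) →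
    EE n (fun x => ones S x * ∏ j ∈ J, (1 - ones (R j) x)) =
      (1/2)^S.card * ∏ j ∈ J, (1 - (1/2:ℝ)^(R j).card) := by
  induction J using Finset.induction_on with
  | empty => intro _ S _; simpa using EE_ones S
  | insert a J ha ih =>
    intro hd S hS
    have hd' : ∀ j ∈ J, ∀ k ∈ J, j ≠ k → Disjoint (R j) (R k) := fun j hj k hk =>
      hd j (Finset.mem_insert_of_mem hj) k (Finset.mem_insert_of_mem hk)
    have h1 := ih hd' S fun j hj => hS j (Finset.mem_insert_of_mem hj)
    have hSa := hS a (Finset.mem_insert_self _ _)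
    have h2 := ih hd' (S ∪ R a) (by
      intro j hj
      rw [Finset.disjoint_union_left]
      refine ⟨hS j (Finset.mem_insert_of_mem hj), ?_⟩
      refine hd a (Finset.mem_insert_self _ _) j (Finset.mem_insert_of_mem hj) ?_
      rintro rfl
      exact ha hj)
    have h3 : (fun x => ones S x * ∏ j ∈ insert a J, (1 - ones (R j) x)) =
        fun x => ones S x * ∏ j ∈ J, (1 - ones (R j) x)
          - ones (S ∪ R a) x * ∏ j ∈ J, (1 - ones (R j) x) := by
      funext x
      rw [Finset.prod_insert ha, ones_union hSa]
      ring
    rw [h3, EE_sub, h1, h2, Finset.prod_insert ha, Finset.card_union_of_disjoint hSa]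
    ring

/-- Test a term until the first zero, continuing with `r`. -/
def termTree {n : ℕ} : List (Fin n) → DecTree n → DecTree n
  | [], _ => .leaf true
  | i :: l, r => .node i r (termTree l r)

/-- Test the terms one after another. -/
def dnfTree {n : ℕ} : List (List (Fin n)) → DecTree n
  | [] => .leaf false
  | l :: ls => termTree l (dnfTree ls)

lemma termTree_eval {n : ℕ} (l : List (Fin n)) (r : DecTree n) (x : Fin n → Bool) :
    (termTree l r).eval x = true ↔ (∀ i ∈ l, x i = true) ∨ r.eval x = true := by
  induction l with
  | nil => simp [termTree, DecTree.eval]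
  | cons i l ih =>
    simp only [termTree, DecTree.eval]
    by_cases h : x i = true <;> simp [h, ih]

lemma dnfTree_eval {n : ℕ} (ls : List (List (Fin n))) (x : Fin n → Bool) :
    (dnfTree ls).eval x = true ↔ ∃ l ∈ ls, ∀ i ∈ l, x i = true := by
  induction ls with
  | nil => simp [dnfTree, DecTree.eval]
  | cons l ls ih => simp [dnfTree, termTree_eval, ih]

lemma cost_nonneg {n : ℕ} (t : DecTree n) (x : Fin n → Bool) :
    0 ≤ DecTree.costOn (fun _ => 1) t x := by
  induction t with
  | leaf b => simp [DecTree.costOn]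
  | node i a b iha ihb =>
    simp only [DecTree.costOn]
    split_ifs <;> linarith

lemma termTree_cost {n : ℕ} (l : List (Fin n)) (r : DecTree n) (x : Fin n → Bool) :
    DecTree.costOn (fun _ => 1) (termTree l r) x ≤
      DecTree.costOn (fun _ => 1) (termTree l (.leaf false)) x
        + DecTree.costOn (fun _ => 1) r x := by
  induction l with
  | nil => simpa [termTree, DecTree.costOn] using cost_nonneg r x
  | cons i l ih =>
    simp only [termTree, DecTree.costOn]
    split_ifs <;> linarith

lemma term_exp {n : ℕ} (l : List (Fin n)) : l.Nodup →
    ∀ S : Finset (Fin n), (∀ i ∈ l, i ∉ S) →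
    EE n (fun x => ones S x * DecTree.costOn (fun _ => 1) (termTree l (.leaf false)) x) ≤
      2 * (1/2)^S.card := by
  induction l with
  | nil =>
    intro _ S _
    simp [termTree, DecTree.costOn, EE]
  | cons i l ih =>
    intro hl S hS
    rw [List.nodup_cons] at hl
    have hi : i ∉ S := hS i (by simp)
    have h1 := ih hl.2 (insert i S) (by
      intro k hk
      rw [Finset.mem_insert]
      rintro (rfl | h)
      · exact hl.1 hk
      · exact hS k (by simp [hk]) h)
    have h2 : (fun x => ones S x * DecTree.costOn (fun _ => 1)
        (termTree (i :: l) (.leaf false)) x) = fun x => ones S x + ones (insert i S) x *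
          DecTree.costOn (fun _ => 1) (termTree l (.leaf false)) x := by
      funext x
      simp only [termTree, DecTree.costOn, ones, Finset.prod_insert hi]
      split_ifs <;> ring
    rw [h2, EE_add, EE_ones]
    rw [Finset.card_insert_of_notMem hi, pow_succ] at h1
    linarith

lemma dnf_exp {n : ℕ} (ls : List (List (Fin n))) (h : ∀ l ∈ ls, l.Nodup) :
    EE n (fun x => DecTree.costOn (fun _ => 1) (dnfTree ls) x) ≤ 2 * ls.length := by
  induction ls with
  | nil => simp [dnfTree, DecTree.costOn, EE]
  | cons l ls ih =>
    have h1 := ih fun l' hl' => h l' (by simp [hl'])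
    have h2 := term_exp l (h l (by simp)) ∅ (by simp)
    have h3 : EE n (fun x => DecTree.costOn (fun _ => 1) (dnfTree (l :: ls)) x) ≤
      EE n (fun x => DecTree.costOn (fun _ => 1) (termTree l (.leaf false)) x
        + DecTree.costOn (fun _ => 1) (dnfTree ls) x) :=
      EE_mono fun x => termTree_cost l (dnfTree ls) x
    rw [EE_add] at h3
    simp [ones] at h2
    push_cast [List.length_cons]
    linarith

lemma OPTA_le (n m : ℕ) (T : Fin m → Finset (Fin n)) (f : (Fin n → Bool) → Bool)
    (hf : IsReadOnceDNF n m T f) :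
    OPTA n f (fun _ => 1) (fun _ => 1/2) ≤ 2 * m := by
  have hb : BddBelow { r : ℝ | ∃ t : DecTree n, DecTree.Computes t f ∧
      r = adExpCost n (fun _ => 1) (fun _ => 1/2) t } := by
    refine ⟨0, ?_⟩
    rintro r ⟨t, _, rfl⟩
    exact Finset.sum_nonneg fun x _ => mul_nonneg (pw_nonneg n x) (cost_nonneg t x)
  have h := dnf_exp (List.ofFn fun j => (T j).toList) (by
    intro l hl
    rw [List.mem_ofFn] at hl
    obtain ⟨j, rfl⟩ := hl
    exact Finset.nodup_toList _)
  rw [List.length_ofFn] at h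
  refine le_trans (csInf_le hb ⟨dnfTree (List.ofFn fun j => (T j).toList), ?_, rfl⟩) h
  intro x
  rw [Bool.eq_iff_iff, dnfTree_eval, hf.2.2]
  simp [List.mem_ofFn]

lemma card_prefix {n : ℕ} (π : Equiv.Perm (Fin n)) {k : ℕ} (hk : k ≤ n) :
    (prefixSet n π k).card = k := by
  have h : prefixSet n π k = (Finset.univ.filter (fun i : Fin n => i.val < k)).map
      π.toEmbedding := by
    ext i
    simp [prefixSet, Finset.mem_map_equiv]
  rw [h, Finset.card_map, Fin.card_filter_val_lt]
  simp [hk]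

lemma prefix_mono {n : ℕ} (π : Equiv.Perm (Fin n)) {k l : ℕ} (h : k ≤ l) :
    prefixSet n π k ⊆ prefixSet n π l := by
  intro i hi
  simp only [prefixSet, Finset.mem_filter, Finset.mem_univ, true_and] at hi ⊢
  omega

lemma naCost_ge {n : ℕ} (f : (Fin n → Bool) → Bool) (π : Equiv.Perm (Fin n))
    (x : Fin n → Bool) {k : ℕ} (hk : k + 1 ≤ n)
    (h : ¬ Determines n f (prefixSet n π k) x) :
    (k : ℝ) + 1 ≤ naCost n f (fun _ => 1) π x := by
  have hmem : naSteps n f π x ∈ {k : ℕ | Determines n f (prefixSet n π k) x} := by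
    apply Nat.sInf_mem
    refine ⟨n, ?_⟩
    intro x' hx'
    congr 1
    funext i
    exact hx' i (by simp [prefixSet])
  have hlt : k + 1 ≤ naSteps n f π x := by
    by_contra hc
    apply h
    intro x' hx'
    exact hmem x' fun i hi => hx' i (prefix_mono π (by omega) hi)
  have hc := Finset.card_le_card (prefix_mono π hlt)
  rw [card_prefix π hk] at hc
  unfold naCost
  simp only [Finset.sum_const, nsmul_eq_mul, mul_one]
  exact_mod_cast hc

lemma not_det {n m : ℕ} (T : Fin m → Finset (Fin n)) (f : (Fin n → Bool) → Bool)
    (hf : IsReadOnceDNF n m T f) (P : Finset (Fin n)) (x : Fin n → Bool)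
    (hx : ¬ f x = true) (j : Fin m) (hj : ∀ i ∈ P ∩ T j, x i = true) :
    ¬ Determines n f P x := by
  intro h
  have := h (fun i => if i ∈ P then x i else true) (fun i hi => by simp [hi])
  apply hx
  rw [← this, hf.2.2]
  refine ⟨j, fun i hi => ?_⟩
  by_cases hP : i ∈ P
  · simp [hP, hj i (Finset.mem_inter.2 ⟨hP, hi⟩)]
  · simp [hP]

lemma na_lower (m : ℕ) (hm : 4 ≤ m) (T : Fin m → Finset (Fin (m * m)))
    (f : (Fin (m * m) → Bool) → Bool) (hc : ∀ j, (T j).card = m)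
    (hf : IsReadOnceDNF (m * m) m T f) (π : Equiv.Perm (Fin (m * m))) :
    (m : ℝ) * (Nat.log 2 m + 1) / 24 ≤
      naExpCost (m * m) f (fun _ => 1) (fun _ => 1/2) π := by
  set L := Nat.log 2 m with hL
  have hLm : L + 1 ≤ m := Nat.log_lt_self 2 (by omega)
  have hpow : 2 ^ L ≤ m := Nat.pow_log_le_self 2 (by omega)
  set k := m * (L + 1) / 2 with hk
  have hk2 : 2 * k ≤ m * (L + 1) := Nat.mul_div_le _ _
  have hk3 : m * (L + 1) ≤ 2 * (k + 1) := by omega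
  have hmm : m * (L + 1) ≤ m * m := Nat.mul_le_mul_left _ hLm
  have hm4 : 4 * 4 ≤ m * m := Nat.mul_le_mul hm hm
  have hkn : k + 1 ≤ m * m := by omega
  set P := prefixSet (m * m) π k with hP
  have hPc : P.card = k := card_prefix π (by omega)
  set H := Finset.univ.filter (fun j : Fin m => L + 1 ≤ (P ∩ T j).card) with hH
  set J := Finset.univ.filter (fun j : Fin m => ¬ L + 1 ≤ (P ∩ T j).card) with hJ
  have hdis : ∀ j k : Fin m, j ≠ k → Disjoint (P ∩ T j) (P ∩ T k) := fun j k hjk =>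
    Disjoint.mono Finset.inter_subset_right Finset.inter_subset_right (hf.2.1 j k hjk)
  have hHk : H.card * (L + 1) ≤ k := by
    rw [← hPc, ← smul_eq_mul]
    refine le_trans (Finset.card_nsmul_le_sum H (fun j => (P ∩ T j).card) (L + 1) ?_) ?_
    · intro j hj
      exact (Finset.mem_filter.1 hj).2
    · rw [← Finset.card_biUnion fun j _ k _ hjk => hdis j k hjk]
      apply Finset.card_le_card
      intro i hi
      rw [Finset.mem_biUnion] at hi
      obtain ⟨j, _, hi⟩ := hi
      exact (Finset.mem_inter.1 hi).1
  have hH2 : 2 * H.card ≤ m := by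
    have : 2 * H.card * (L + 1) ≤ m * (L + 1) := by nlinarith
    exact Nat.le_of_mul_le_mul_right this (by omega)
  have hHJ : H.card + J.card = m := by
    have := Finset.card_filter_add_card_filter_not (s := (Finset.univ : Finset (Fin m)))
      (fun j : Fin m => L + 1 ≤ (P ∩ T j).card)
    rwa [Finset.card_univ, Fintype.card_fin] at this
  have hJ2 : m ≤ 2 * J.card := by omega
  have hm0 : (0:ℝ) < m := by exact_mod_cast (by omega : 0 < m)
  -- probability that every light term has a tested zero
  have hA : EE (m * m) (fun x => ∏ j ∈ J, (1 - ones (P ∩ T j) x)) ≤ 2 / 3 := by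
    have h1 := EE_prod (fun j => P ∩ T j) J (fun j _ k _ h => hdis j k h) ∅ (by simp)
    simp only [ones, Finset.prod_empty, one_mul, Finset.card_empty, pow_zero] at h1
    simp only [ones]
    rw [h1]
    have h2 : ∏ j ∈ J, (1 - (1/2:ℝ)^(P ∩ T j).card) ≤ ∏ j ∈ J, Real.exp (-(1/m)) := by
      apply Finset.prod_le_prod
      · intro j _
        have : (1/2:ℝ)^(P ∩ T j).card ≤ 1 := pow_le_one₀ (by norm_num) (by norm_num)
        linarith
      · intro j hj
        have hj' : (P ∩ T j).card ≤ L := by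
          have := (Finset.mem_filter.1 hj).2
          omega
        have h3 : (1/2:ℝ)^L ≤ (1/2:ℝ)^(P ∩ T j).card :=
          pow_le_pow_of_le_one (by norm_num) (by norm_num) hj'
        have h4 : 1/(m:ℝ) ≤ (1/2:ℝ)^L := by
          rw [one_div_pow]
          apply one_div_le_one_div_of_le (by positivity)
          exact_mod_cast hpow
        have := Real.add_one_le_exp (-(1/(m:ℝ)))
        linarith
    refine h2.trans ?_
    rw [Finset.prod_const, ← Real.exp_nat_mul]
    have h5 : (J.card : ℝ) * -(1/m) ≤ -(1/2) := by
      have : (m:ℝ) ≤ 2 * J.card := by exact_mod_cast hJ2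
      have : (1/2:ℝ) ≤ J.card * (1/m) := by
        rw [mul_one_div, le_div_iff₀ hm0]
        linarith
      linarith
    refine (Real.exp_le_exp.2 h5).trans ?_
    rw [Real.exp_neg]
    have := Real.add_one_le_exp (1/2:ℝ)
    rw [inv_le_comm₀ (Real.exp_pos _) (by norm_num)]
    norm_num at this ⊢
    linarith
  have hB : EE (m * m) (fun x => ∑ j, ones (T j) x) ≤ 1 / 4 := by
    rw [EE_sum]
    simp only [fun j => EE_ones (T j), hc, Finset.sum_const, Finset.card_univ, Fintype.card_fin,
      nsmul_eq_mul]
    have h4 : ∀ m : ℕ, 4 ≤ m → 4 * m ≤ 2 ^ m := by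
      intro m hm
      induction m, hm using Nat.le_induction with
      | base => norm_num
      | succ q hq ih => rw [pow_succ]; omega
    have h5 : (4 * m : ℝ) ≤ 2 ^ m := by exact_mod_cast h4 m hm
    rw [one_div_pow, mul_one_div, div_le_iff₀ (by positivity)]
    linarith
  have hones : ∀ (S : Finset (Fin (m * m))) x, 0 ≤ ones S x ∧ ones S x ≤ 1 := by
    intro S x
    rw [ones_eq]
    split_ifs <;> norm_num
  have hpt : ∀ x, ((k:ℝ) + 1) * (1 - ∑ j, ones (T j) x - ∏ j ∈ J, (1 - ones (P ∩ T j) x)) ≤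
      naCost (m * m) f (fun _ => 1) π x := by
    intro x
    have hn0 : 0 ≤ naCost (m * m) f (fun _ => 1) π x :=
      Finset.sum_nonneg fun _ _ => zero_le_one
    have hs0 : 0 ≤ ∑ j, ones (T j) x := Finset.sum_nonneg fun j _ => (hones _ x).1
    have hp0 : 0 ≤ ∏ j ∈ J, (1 - ones (P ∩ T j) x) :=
      Finset.prod_nonneg fun j _ => by linarith [(hones (P ∩ T j) x).2]
    have hk0 : (0:ℝ) ≤ (k:ℝ) + 1 := by positivity
    by_cases hfx : f x = true
    · obtain ⟨j, hj⟩ := (hf.2.2 x).1 hfx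
      have h1 : ones (T j) x = 1 := by rw [ones_eq, if_pos hj]
      have h2 : ones (T j) x ≤ ∑ j, ones (T j) x :=
        Finset.single_le_sum (f := fun j => ones (T j) x) (fun j _ => (hones _ x).1)
          (Finset.mem_univ j)
      refine le_trans (mul_nonpos_of_nonneg_of_nonpos hk0 ?_) hn0
      linarith
    · by_cases hj : ∃ j ∈ J, ∀ i ∈ P ∩ T j, x i = true
      · obtain ⟨j, _, hj⟩ := hj
        have h1 := naCost_ge f π x hkn (not_det T f hf P x hfx j hj)
        nlinarith
      · push Not at hj
        have h1 : ∏ j ∈ J, (1 - ones (P ∩ T j) x) = 1 := by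
          apply Finset.prod_eq_one
          intro j hjJ
          obtain ⟨i, hi, hxi⟩ := hj j hjJ
          rw [ones_eq, if_neg (fun h => hxi (h i hi))]
          ring
        refine le_trans (mul_nonpos_of_nonneg_of_nonpos hk0 ?_) hn0
        linarith
  have hfin := EE_mono hpt
  rw [EE_mul, EE_sub, EE_sub, EE_one] at hfin
  have h6 : (m:ℝ) * (L + 1) ≤ 2 * (k + 1) := by exact_mod_cast hk3
  have h7 : naExpCost (m * m) f (fun _ => 1) (fun _ => 1/2) π =
    EE (m * m) (fun x => naCost (m * m) f (fun _ => 1) π x) := rfl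
  rw [h7]
  refine le_trans ?_ hfin
  have hk0 : (0:ℝ) ≤ (k:ℝ) + 1 := by positivity
  nlinarith

/-- There is a constant `c > 0` such that for every `m ≥ 4`, with `n = m²` and `f` the
monotone read-once DNF consisting of `m` pairwise-disjoint terms of `m` variables each
(so all `n` variables appear), under unit costs and the uniform distribution
`OPT_N(f) ≥ c · log₂ n · OPT_A(f)`. -/
theorem stmt1 :
    ∃ c : ℝ, 0 < c ∧
      ∀ m : ℕ, 4 ≤ m →
        ∀ (T : Fin m → Finset (Fin (m * m))) (f : (Fin (m * m) → Bool) → Bool),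
          (∀ j, (T j).card = m) →
          IsReadOnceDNF (m * m) m T f →
          c * Real.logb 2 (m * m) * OPTA (m * m) f (fun _ => 1) (fun _ => 1/2) ≤
            OPTN (m * m) f (fun _ => 1) (fun _ => 1/2) := by
  refine ⟨1/96, by norm_num, ?_⟩
  intro m hm T f hc hf
  have hA := OPTA_le (m * m) m T f hf
  have hN : (m : ℝ) * (Nat.log 2 m + 1) / 24 ≤
      OPTN (m * m) f (fun _ => 1) (fun _ => 1/2) := by
    apply le_csInf
    · exact ⟨_, 1, rfl⟩
    · rintro r ⟨π, rfl⟩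
      exact na_lower m hm T f hc hf π
  have hm0 : (0:ℝ) < m := by exact_mod_cast (by omega : 0 < m)
  have hm1 : (1:ℝ) ≤ m := by exact_mod_cast (by omega : 1 ≤ m)
  have hlog : Real.logb 2 m ≤ Nat.log 2 m + 1 := by
    rw [Real.logb_le_iff_le_rpow (by norm_num) hm0]
    have := (Nat.lt_pow_succ_log_self (b := 2) (by norm_num) m).le
    have h2 : ((2:ℝ) ^ ((Nat.log 2 m : ℝ) + 1)) = ((2 ^ (Nat.log 2 m + 1) : ℕ) : ℝ) := by
      rw [← Nat.cast_add_one, Real.rpow_natCast]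
      push_cast
      rfl
    rw [h2]
    exact_mod_cast this
  have hlog0 : 0 ≤ Real.logb 2 m := Real.logb_nonneg (by norm_num) hm1
  rw [Real.logb_mul hm0.ne' hm0.ne']
  refine le_trans ?_ hN
  have h1 : 1/96 * (Real.logb 2 m + Real.logb 2 m) *
      OPTA (m * m) f (fun _ => 1) (fun _ => 1/2) ≤
      1/96 * (Real.logb 2 m + Real.logb 2 m) * (2 * m) :=
    mul_le_mul_of_nonneg_left hA (by positivity)
  refine h1.trans ?_
  nlinarith
end

section
/- There is a constant K > 0 such that for every ε ∈ (0, 1/2] and every integer d ≥ 1, letting n = 2^{d+1} − 2 and letting f : {0,1}^n → {0,1} be the tree-connectivity function of the complete rooted binary tree of depth d, under unit costs and probabilities p_i = (1+ε)/2 for all i ∈ {1,…,n} one has OPT_N(f) ≥ K · ε³ · n^{1 − 2ε/ln 2} · OPT_A(f). -/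
open Finset

/-- Nodes of the complete rooted binary tree of depth `d` are numbered `1, …, 2^(d+1)-1`,
with root `1` and the children of `v` being `2v` and `2v+1`; the edge joining a non-root
node `v` to its parent `v/2` is identified with the variable index `v - 2 ∈ Fin (2^(d+1)-2)`.
`edgeVal d x v` is the value of the edge above node `v`. -/
def edgeVal (d : ℕ) (x : Fin (2 ^ (d + 1) - 2) → Bool) (v : ℕ) : Bool :=
  if h : v - 2 < 2 ^ (d + 1) - 2 then x ⟨v - 2, h⟩ else false

/-- The leaf at node `v` (where `2^d ≤ v < 2^(d+1)`) is alive: every edge on the path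
from the root to `v` has value `1`. -/
def leafAlive (d : ℕ) (x : Fin (2 ^ (d + 1) - 2) → Bool) (v : ℕ) : Bool :=
  decide (∀ j ∈ Finset.range d, edgeVal d x (v / 2 ^ j) = true)

/-- The tree-connectivity function of the complete rooted binary tree of depth `d`:
true iff at least one leaf is alive. -/
def treeConn (d : ℕ) (x : Fin (2 ^ (d + 1) - 2) → Bool) : Bool :=
  decide (∃ v ∈ Finset.Ico ((2 : ℕ) ^ d) ((2 : ℕ) ^ (d + 1)), leafAlive d x v = true)

/-! ### Product weights -/

lemma sum_prodWeight (n : ℕ) (p : ℝ) :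
    ∑ x : Fin n → Bool, prodWeight n (fun _ => p) x = 1 := by
  have h := Finset.prod_univ_sum (fun _ : Fin n => (Finset.univ : Finset Bool))
    (fun _ b => if b then p else 1 - p)
  unfold prodWeight
  rw [Fintype.piFinset_univ] at h
  rw [← h]
  simp

lemma prodWeight_nonneg (n : ℕ) (p : ℝ) (h0 : 0 ≤ p) (h1 : p ≤ 1) (x : Fin n → Bool) :
    0 ≤ prodWeight n (fun _ => p) x := by
  unfold prodWeight
  apply Finset.prod_nonneg
  intro i _
  split_ifs <;> linarith

/-- Flip coordinate `i`. -/
def flipAt {n : ℕ} (i : Fin n) (x : Fin n → Bool) : Fin n → Bool :=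
  Function.update x i (!x i)

lemma flipAt_flipAt {n : ℕ} (i : Fin n) (x : Fin n → Bool) : flipAt i (flipAt i x) = x := by
  funext j
  by_cases h : j = i
  · subst h; simp [flipAt]
  · simp [flipAt, h]

lemma cond_sum {n : ℕ} (p : ℝ) (i : Fin n) (h : (Fin n → Bool) → ℝ)
    (hi : ∀ x, h (flipAt i x) = h x) :
    ∑ x : Fin n → Bool, prodWeight n (fun _ => p) x * (if x i then h x else 0)
      = p * ∑ x : Fin n → Bool, prodWeight n (fun _ => p) x * h x ∧
    ∑ x : Fin n → Bool, prodWeight n (fun _ => p) x * (if x i then 0 else h x)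
      = (1 - p) * ∑ x : Fin n → Bool, prodWeight n (fun _ => p) x * h x := by
  classical
  set V : (Fin n → Bool) → ℝ := fun x =>
    (∏ j ∈ Finset.univ.erase i, if x j then p else 1 - p) * h x with hV
  have hVf : ∀ x, V (flipAt i x) = V x := by
    intro x
    simp only [hV, hi]
    congr 1
    apply Finset.prod_congr rfl
    intro j hj
    have : j ≠ i := (Finset.mem_erase.1 hj).1
    simp [flipAt, this]
  have hW : ∀ x, prodWeight n (fun _ => p) x * h x = (if x i then p else 1 - p) * V x := by
    intro x
    simp only [hV, prodWeight]
    rw [← Finset.mul_prod_erase Finset.univ _ (Finset.mem_univ i)]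
    ring
  have hAB : ∑ x : Fin n → Bool, (if x i then V x else 0)
      = ∑ x : Fin n → Bool, (if x i then 0 else V x) := by
    have := Equiv.sum_comp (⟨flipAt i, flipAt i, flipAt_flipAt i, flipAt_flipAt i⟩ :
      Equiv (Fin n → Bool) (Fin n → Bool)) (fun x => if x i then V x else 0)
    rw [← this]
    apply Finset.sum_congr rfl
    intro x _
    simp only [Equiv.coe_fn_mk, hVf]
    cases hx : x i <;> simp [flipAt, hx]
  have e1 : ∑ x : Fin n → Bool, prodWeight n (fun _ => p) x * (if x i then h x else 0)
      = p * ∑ x : Fin n → Bool, (if x i then V x else 0) := by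
    rw [Finset.mul_sum]
    apply Finset.sum_congr rfl
    intro x _
    have := hW x
    cases hx : x i <;> simp [hx] at this ⊢
    exact this
  have e2 : ∑ x : Fin n → Bool, prodWeight n (fun _ => p) x * (if x i then 0 else h x)
      = (1 - p) * ∑ x : Fin n → Bool, (if x i then 0 else V x) := by
    rw [Finset.mul_sum]
    apply Finset.sum_congr rfl
    intro x _
    have := hW x
    cases hx : x i <;> simp [hx] at this ⊢
    exact this
  have e3 : ∑ x : Fin n → Bool, prodWeight n (fun _ => p) x * h x
      = ∑ x : Fin n → Bool, (if x i then V x else 0) := by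
    have : ∑ x : Fin n → Bool, prodWeight n (fun _ => p) x * h x
      = ∑ x : Fin n → Bool, prodWeight n (fun _ => p) x * (if x i then h x else 0)
      + ∑ x : Fin n → Bool, prodWeight n (fun _ => p) x * (if x i then 0 else h x) := by
      rw [← Finset.sum_add_distrib]
      apply Finset.sum_congr rfl
      intro x _
      split_ifs <;> ring
    rw [this, e1, e2, ← hAB]
    ring
  rw [e1, e2, e3, hAB]
  exact ⟨rfl, rfl⟩

lemma sum_all_true {n : ℕ} (p : ℝ) (S : Finset (Fin n)) :
    ∑ x : Fin n → Bool, prodWeight n (fun _ => p) x * (if ∀ i ∈ S, x i = true then 1 else 0)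
      = p ^ S.card := by
  classical
  induction S using Finset.induction_on with
  | empty => simp [sum_prodWeight]
  | insert i S hi ih =>
    rw [Finset.card_insert_of_notMem hi, pow_succ, mul_comm, ← ih]
    rw [← (cond_sum p i (fun x => if ∀ i ∈ S, x i = true then 1 else 0) ?_).1]
    · apply Finset.sum_congr rfl
      intro x _
      cases hx : x i <;> simp [hx]
    · intro x
      have : (∀ j ∈ S, flipAt i x j = true) ↔ (∀ j ∈ S, x j = true) := by
        apply forall₂_congr
        intro j hj
        have : j ≠ i := fun h => hi (h ▸ hj)
        simp [flipAt, this]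
      simp only [this]

/-! ### Read-once decision trees -/

/-- The variable `i` does not occur in the tree. -/
def Avoids {n : ℕ} (i : Fin n) : DecTree n → Prop
  | .leaf _ => True
  | .node j t0 t1 => j ≠ i ∧ Avoids i t0 ∧ Avoids i t1

/-- No variable is repeated along a path. -/
def ReadOnce {n : ℕ} : DecTree n → Prop
  | .leaf _ => True
  | .node j t0 t1 => Avoids j t0 ∧ Avoids j t1 ∧ ReadOnce t0 ∧ ReadOnce t1

/-- Recursively computed expected cost. -/
def recE {n : ℕ} (p : ℝ) : DecTree n → ℝ
  | .leaf _ => 0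
  | .node _ t0 t1 => 1 + p * recE p t1 + (1 - p) * recE p t0

/-- Recursively computed acceptance probability. -/
def recP {n : ℕ} (p : ℝ) : DecTree n → ℝ
  | .leaf b => if b then 1 else 0
  | .node _ t0 t1 => p * recP p t1 + (1 - p) * recP p t0

lemma eval_flip {n : ℕ} (i : Fin n) (x : Fin n → Bool) (t : DecTree n) (h : Avoids i t) :
    t.eval (flipAt i x) = t.eval x := by
  induction t with
  | leaf b => rfl
  | node j t0 t1 ih0 ih1 =>
    obtain ⟨hj, h0, h1⟩ := h
    simp only [DecTree.eval, ih0 h0, ih1 h1]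
    simp [flipAt, hj]

lemma costOn_flip {n : ℕ} (c : Fin n → ℝ) (i : Fin n) (x : Fin n → Bool) (t : DecTree n)
    (h : Avoids i t) : t.costOn c (flipAt i x) = t.costOn c x := by
  induction t with
  | leaf b => rfl
  | node j t0 t1 ih0 ih1 =>
    obtain ⟨hj, h0, h1⟩ := h
    simp only [DecTree.costOn, ih0 h0, ih1 h1]
    simp [flipAt, hj]

lemma recE_eq {n : ℕ} (p : ℝ) (t : DecTree n) (h : ReadOnce t) :
    adExpCost n (fun _ => 1) (fun _ => p) t = recE p t := by
  unfold adExpCost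
  induction t with
  | leaf b => simp [DecTree.costOn, recE]
  | node j t0 t1 ih0 ih1 =>
    obtain ⟨a0, a1, h0, h1⟩ := h
    rw [recE, ← ih0 h0, ← ih1 h1,
      ← (cond_sum p j _ (fun x => costOn_flip _ j x t1 a1)).1,
      ← (cond_sum p j _ (fun x => costOn_flip _ j x t0 a0)).2]
    have e1 := sum_prodWeight n p
    rw [add_assoc, ← Finset.sum_add_distrib]
    refine Eq.trans ?_ (congrArg (fun y : ℝ => y + _) e1)
    beta_reduce
    rw [← Finset.sum_add_distrib]
    apply Finset.sum_congr rfl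
    intro x _
    simp only [DecTree.costOn]
    by_cases hx : x j = true
    · simp only [hx, if_true]; ring
    · simp only [hx, if_false, Bool.false_eq_true]; ring

lemma recP_eq {n : ℕ} (p : ℝ) (t : DecTree n) (h : ReadOnce t) :
    ∑ x : Fin n → Bool, prodWeight n (fun _ => p) x * (if t.eval x then 1 else 0) = recP p t := by
  induction t with
  | leaf b => 
    cases b
    · simp [DecTree.eval, recP]
    · simp [DecTree.eval, recP, sum_prodWeight]
  | node j t0 t1 ih0 ih1 =>
    obtain ⟨a0, a1, h0, h1⟩ := h
    rw [recP, ← ih0 h0, ← ih1 h1,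
      ← (cond_sum p j (fun x => if t1.eval x then 1 else 0)
          (fun x => by simp only [eval_flip j x t1 a1])).1,
      ← (cond_sum p j (fun x => if t0.eval x then 1 else 0)
          (fun x => by simp only [eval_flip j x t0 a0])).2,
      ← Finset.sum_add_distrib]
    apply Finset.sum_congr rfl
    intro x _
    simp only [DecTree.eval]
    by_cases hx : x j = true
    · simp only [hx, if_true]; ring
    · simp only [hx, if_false, Bool.false_eq_true]; ring

/-! ### Depth-first search -/

/-- index of the edge above node `w` -/
def eIdx {n : ℕ} (hn : 0 < n) (w : ℕ) : Fin n :=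
  if h : w - 2 < n then ⟨w - 2, h⟩ else ⟨0, hn⟩

/-- Depth first search below node `v` (height `m`), continuing with `F` on failure. -/
def dfs {n : ℕ} (hn : 0 < n) : ℕ → ℕ → DecTree n → DecTree n
  | 0, _, _ => .leaf true
  | m + 1, v, F =>
      .node (eIdx hn (2 * v))
        (.node (eIdx hn (2 * v + 1)) F (dfs hn m (2 * v + 1) F))
        (dfs hn m (2 * v) (.node (eIdx hn (2 * v + 1)) F (dfs hn m (2 * v + 1) F)))

/-- Some leaf below `v` is alive. -/
def alive {n : ℕ} (hn : 0 < n) (x : Fin n → Bool) : ℕ → ℕ → Prop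
  | 0, _ => True
  | m + 1, v => (x (eIdx hn (2 * v)) = true ∧ alive hn x m (2 * v)) ∨
      (x (eIdx hn (2 * v + 1)) = true ∧ alive hn x m (2 * v + 1))

lemma dfs_eval {n : ℕ} (hn : 0 < n) (x : Fin n → Bool) (m : ℕ) :
    ∀ (v : ℕ) (F : DecTree n), (dfs hn m v F).eval x = true ↔
      alive hn x m v ∨ F.eval x = true := by
  induction m with
  | zero => intro v F; simp [dfs, alive, DecTree.eval]
  | succ m ih =>
    intro v F
    cases h1 : x (eIdx hn (2 * v)) <;> cases h2 : x (eIdx hn (2 * v + 1)) <;>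
      simp [dfs, alive, DecTree.eval, h1, h2, ih, or_assoc]

/-- survival probability -/
def qs (p : ℝ) : ℕ → ℝ
  | 0 => 1
  | m + 1 => 1 - (1 - p * qs p m) ^ 2

/-- DFS cost -/
def As (p : ℝ) : ℕ → ℝ
  | 0 => 0
  | m + 1 => (2 - p * qs p m) * (1 + p * As p m)

lemma dfs_recP {n : ℕ} (hn : 0 < n) (p : ℝ) (m : ℕ) :
    ∀ (v : ℕ) (F : DecTree n), recP p (dfs hn m v F) = qs p m + (1 - qs p m) * recP p F := by
  induction m with
  | zero => intro v F; simp [dfs, recP, qs]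
  | succ m ih =>
    intro v F
    simp only [dfs, recP, ih, qs]
    ring

lemma dfs_recE {n : ℕ} (hn : 0 < n) (p : ℝ) (m : ℕ) :
    ∀ (v : ℕ) (F : DecTree n), recE p (dfs hn m v F) = As p m + (1 - qs p m) * recE p F := by
  induction m with
  | zero => intro v F; simp [dfs, recE, qs, As]
  | succ m ih =>
    intro v F
    simp only [dfs, recE, ih, qs, As]
    ring

/-- `w` is a strict descendant of `v`. -/
def Desc (v w : ℕ) : Prop := ∃ j, 1 ≤ j ∧ w / 2 ^ j = v

lemma desc_even {v w : ℕ} (h : Desc (2 * v) w) : Desc v w := by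
  obtain ⟨j, hj, h⟩ := h
  refine ⟨j + 1, by omega, ?_⟩
  rw [pow_succ, ← Nat.div_div_eq_div_mul, h]; omega

lemma desc_odd {v w : ℕ} (h : Desc (2 * v + 1) w) : Desc v w := by
  obtain ⟨j, hj, h⟩ := h
  refine ⟨j + 1, by omega, ?_⟩
  rw [pow_succ, ← Nat.div_div_eq_div_mul, h]; omega

lemma desc_lt {v w : ℕ} (hv : 1 ≤ v) (h : Desc v w) : 2 * v ≤ w := by
  obtain ⟨j, hj, h⟩ := h
  obtain ⟨k, rfl⟩ : ∃ k, j = k + 1 := ⟨j - 1, by omega⟩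
  rw [pow_succ', ← Nat.div_div_eq_div_mul] at h
  have := Nat.div_le_self (w / 2) (2 ^ k)
  omega

lemma div_pow_cmp {a b w j k : ℕ} (ha : w / 2 ^ j = a) (hb : w / 2 ^ k = b) (h : j < k) :
    b ≤ a / 2 := by
  obtain ⟨l, rfl⟩ : ∃ l, k = j + 1 + l := ⟨k - j - 1, by omega⟩
  rw [pow_add, pow_succ, ← Nat.div_div_eq_div_mul, ← Nat.div_div_eq_div_mul, ha] at hb
  rw [← hb]
  exact Nat.div_le_self _ _

lemma desc_disj {v w : ℕ} (hv : 1 ≤ v) (h : Desc (2 * v) w) (h' : Desc (2 * v + 1) w) : False := by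
  obtain ⟨j, hj, h⟩ := h
  obtain ⟨k, hk, h'⟩ := h'
  rcases lt_trichotomy j k with hjk | hjk | hjk
  · have := div_pow_cmp h h' hjk; omega
  · subst hjk; omega
  · have := div_pow_cmp h' h hjk; omega

lemma eIdx_val {n : ℕ} (hn : 0 < n) {w : ℕ} (h2 : 2 ≤ w) (h : w < n + 2) :
    (eIdx hn w).val + 2 = w := by
  unfold eIdx
  rw [dif_pos (by omega)]
  simp; omega

lemma dfs_avoids {n : ℕ} (hn : 0 < n) (i : Fin n) (m : ℕ) :
    ∀ (v : ℕ) (F : DecTree n), 1 ≤ v → (v + 1) * 2 ^ m ≤ n + 2 → Avoids i F →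
      ¬ Desc v (i.val + 2) → Avoids i (dfs hn m v F) := by
  induction m with
  | zero => intro v F _ _ _ _; exact trivial
  | succ m ih =>
    intro v F hv hle hF hd
    have hp : 1 ≤ 2 ^ m := Nat.one_le_two_pow
    have hle' : (2 * v + 1 + 1) * 2 ^ m ≤ n + 2 := by
      calc _ = (v + 1) * 2 ^ (m + 1) := by ring
        _ ≤ _ := hle
    have hle2 : (2 * v + 1) * 2 ^ m ≤ n + 2 := by nlinarith
    have hb : 2 * v + 2 ≤ n + 2 := by nlinarith
    have a1 : eIdx hn (2 * v) ≠ i := by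
      rintro rfl
      rw [eIdx_val hn (by omega) (by omega)] at hd
      exact hd ⟨1, le_rfl, by omega⟩
    have a2 : eIdx hn (2 * v + 1) ≠ i := by
      rintro rfl
      rw [eIdx_val hn (by omega) (by omega)] at hd
      exact hd ⟨1, le_rfl, by omega⟩
    have hR : Avoids i (.node (eIdx hn (2 * v + 1)) F (dfs hn m (2 * v + 1) F)) :=
      ⟨a2, hF, ih _ _ (by omega) hle' hF (fun h => hd (desc_odd h))⟩
    exact ⟨a1, hR, ih _ _ (by omega) hle2 hR (fun h => hd (desc_even h))⟩

lemma dfs_readOnce {n : ℕ} (hn : 0 < n) (m : ℕ) :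
    ∀ (v : ℕ) (F : DecTree n), 1 ≤ v → (v + 1) * 2 ^ m ≤ n + 2 → ReadOnce F →
      (∀ i : Fin n, Desc v (i.val + 2) → Avoids i F) → ReadOnce (dfs hn m v F) := by
  induction m with
  | zero => intro v F _ _ _ _; exact trivial
  | succ m ih =>
    intro v F hv hle hF hd
    have hp : 1 ≤ 2 ^ m := Nat.one_le_two_pow
    have hle' : (2 * v + 1 + 1) * 2 ^ m ≤ n + 2 := by
      calc _ = (v + 1) * 2 ^ (m + 1) := by ring
        _ ≤ _ := hle
    have hle2 : (2 * v + 1) * 2 ^ m ≤ n + 2 := by nlinarith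
    have hb : 2 * v + 2 ≤ n + 2 := by nlinarith
    have v1 := eIdx_val hn (w := 2 * v) (by omega) (by omega)
    have v2 := eIdx_val hn (w := 2 * v + 1) (by omega) (by omega)
    have d1 : Desc v ((eIdx hn (2 * v)).val + 2) := by
      rw [v1]; exact ⟨1, le_rfl, by omega⟩
    have d2 : Desc v ((eIdx hn (2 * v + 1)).val + 2) := by
      rw [v2]; exact ⟨1, le_rfl, by omega⟩
    have n2 : ¬ Desc (2 * v + 1) ((eIdx hn (2 * v + 1)).val + 2) := by
      rw [v2]; intro h; have := desc_lt (by omega) h; omega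
    have n1 : ¬ Desc (2 * v) ((eIdx hn (2 * v)).val + 2) := by
      rw [v1]; intro h; have := desc_lt (by omega) h; omega
    have n12 : ¬ Desc (2 * v + 1) ((eIdx hn (2 * v)).val + 2) := by
      rw [v1]; intro h; have := desc_lt (by omega) h; omega
    have hne : eIdx hn (2 * v + 1) ≠ eIdx hn (2 * v) := by
      intro h; rw [h] at v2; omega
    have hR : ReadOnce (.node (eIdx hn (2 * v + 1)) F (dfs hn m (2 * v + 1) F)) :=
      ⟨hd _ d2, dfs_avoids hn _ m _ _ (by omega) hle' (hd _ d2) n2, hF,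
        ih _ _ (by omega) hle' hF (fun i h => hd i (desc_odd h))⟩
    have aR : ∀ i : Fin n, Desc v (i.val + 2) → eIdx hn (2 * v + 1) ≠ i →
        ¬ Desc (2 * v + 1) (i.val + 2) →
        Avoids i (.node (eIdx hn (2 * v + 1)) F (dfs hn m (2 * v + 1) F)) := fun i h1 h2 h3 =>
      ⟨h2, hd i h1, dfs_avoids hn i m _ _ (by omega) hle' (hd i h1) h3⟩
    refine ⟨aR _ d1 hne n12, dfs_avoids hn _ m _ _ (by omega) hle2 (aR _ d1 hne n12) n1, hR,
      ih _ _ (by omega) hle2 hR ?_⟩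
    intro i hi
    refine aR i (desc_even hi) ?_ (fun h => desc_disj hv hi h)
    rintro rfl
    rw [v2] at hi
    have := desc_lt (by omega) hi
    omega

/-! ### The tree connectivity function -/

lemma edgeVal_eq (d : ℕ) (hn : 0 < 2 ^ (d + 1) - 2) (x : Fin (2 ^ (d + 1) - 2) → Bool) (w : ℕ)
    (h2 : 2 ≤ w) (h : w < 2 ^ (d + 1)) : edgeVal d x w = x (eIdx hn w) := by
  unfold edgeVal eIdx
  rw [dif_pos (by omega), dif_pos (by omega)]

lemma alive_iff (d : ℕ) (hn : 0 < 2 ^ (d + 1) - 2) (x : Fin (2 ^ (d + 1) - 2) → Bool) (m : ℕ) :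
    ∀ v, 1 ≤ v → (v + 1) * 2 ^ m ≤ 2 ^ (d + 1) →
      (alive hn x m v ↔ ∃ w, w / 2 ^ m = v ∧ ∀ j < m, edgeVal d x (w / 2 ^ j) = true) := by
  induction m with
  | zero => intro v _ _; simp [alive]
  | succ m ih =>
    intro v hv hle
    have hp : 1 ≤ 2 ^ m := Nat.one_le_two_pow
    have hle' : (2 * v + 1 + 1) * 2 ^ m ≤ 2 ^ (d + 1) := by
      calc _ = (v + 1) * 2 ^ (m + 1) := by ring
        _ ≤ _ := hle
    have hle2 : (2 * v + 1) * 2 ^ m ≤ 2 ^ (d + 1) := by nlinarith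
    have hb : 2 * v + 2 ≤ 2 ^ (d + 1) := by nlinarith
    rw [alive, ih _ (by omega) hle2, ih _ (by omega) hle',
      ← edgeVal_eq d hn x _ (by omega) (by omega), ← edgeVal_eq d hn x _ (by omega) (by omega)]
    constructor
    · rintro (⟨he, w, hw, h⟩ | ⟨he, w, hw, h⟩)
      all_goals
        refine ⟨w, ?_, ?_⟩
        · rw [pow_succ, ← Nat.div_div_eq_div_mul, hw]; omega
        · intro j hj
          rcases Nat.lt_succ_iff_lt_or_eq.1 hj with hj | rfl
          · exact h j hj
          · rw [hw]; exact he
    · rintro ⟨w, hw, h⟩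
      rw [pow_succ, ← Nat.div_div_eq_div_mul] at hw
      have h3 : w / 2 ^ m = 2 * v ∨ w / 2 ^ m = 2 * v + 1 := by omega
      have hm := h m (by omega)
      rcases h3 with h3 | h3
      · left; rw [h3] at hm; exact ⟨hm, w, h3, fun j hj => h j (by omega)⟩
      · right; rw [h3] at hm; exact ⟨hm, w, h3, fun j hj => h j (by omega)⟩

lemma treeConn_iff (d : ℕ) (hn : 0 < 2 ^ (d + 1) - 2) (x : Fin (2 ^ (d + 1) - 2) → Bool) :
    treeConn d x = true ↔ alive hn x d 1 := by
  rw [alive_iff d hn x d 1 le_rfl (by rw [pow_succ]; omega)]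
  rw [treeConn, decide_eq_true_eq]
  apply exists_congr
  intro w
  rw [leafAlive, decide_eq_true_eq]
  simp only [Finset.mem_Ico, Finset.mem_range]
  have hp : 0 < 2 ^ d := by positivity
  have : w / 2 ^ d = 1 ↔ 2 ^ d ≤ w ∧ w < 2 ^ (d + 1) := by
    rw [Nat.div_eq_iff hp]
    rw [pow_succ]; omega
  rw [this]

/-- The DFS tree. -/
def dfsTree (d : ℕ) (hn : 0 < 2 ^ (d + 1) - 2) : DecTree (2 ^ (d + 1) - 2) :=
  dfs hn d 1 (.leaf false)

lemma dfsTree_computes (d : ℕ) (hn : 0 < 2 ^ (d + 1) - 2) :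
    (dfsTree d hn).Computes (treeConn d) := by
  intro x
  rw [Bool.eq_iff_iff, treeConn_iff d hn, dfsTree, dfs_eval]
  simp [DecTree.eval]

lemma dfsTree_readOnce (d : ℕ) (hn : 0 < 2 ^ (d + 1) - 2) : ReadOnce (dfsTree d hn) :=
  dfs_readOnce hn d 1 _ le_rfl (by have := pow_succ 2 d; omega) trivial (fun _ _ => trivial)

/-! ### Numerical bounds -/

lemma qs_bounds (p : ℝ) (hp : 1 / 2 < p) (hp1 : p ≤ 1) (m : ℕ) :
    (2 * p - 1) / p ^ 2 ≤ qs p m ∧ qs p m ≤ 1 := by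
  have hp0 : 0 < p := by linarith
  induction m with
  | zero =>
    refine ⟨?_, le_rfl⟩
    rw [qs, div_le_one (by positivity)]
    nlinarith [sq_nonneg (p - 1)]
  | succ m ih =>
    obtain ⟨h1, h2⟩ := ih
    rw [qs]
    refine ⟨?_, by nlinarith [sq_nonneg (1 - p * qs p m)]⟩
    set q := (2 * p - 1) / p ^ 2 with hq
    have hqe : q = 1 - (1 - p * q) ^ 2 := by
      rw [hq]; field_simp; ring
    have hb : 0 ≤ 1 - p * qs p m := by nlinarith
    have hc : 1 - p * qs p m ≤ 1 - p * q := by nlinarith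
    have : (1 - p * qs p m) ^ 2 ≤ (1 - p * q) ^ 2 := pow_le_pow_left₀ hb hc 2
    linarith

lemma As_bound (p : ℝ) (hp : 1 / 2 < p) (hp1 : p ≤ 1) (m : ℕ) :
    0 ≤ As p m ∧ As p m ≤ 2 * m := by
  have hp0 : 0 < p := by linarith
  induction m with
  | zero => simp [As]
  | succ m ih =>
    obtain ⟨h0, h1⟩ := ih
    obtain ⟨hq1, hq2⟩ := qs_bounds p hp hp1 m
    rw [As]
    have hx : 0 ≤ 2 - p * qs p m := by nlinarith
    have hy : 2 - p * qs p m ≤ 1 / p := by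
      have : p * ((2 * p - 1) / p ^ 2) = 2 - 1 / p := by field_simp
      nlinarith
    refine ⟨by positivity, ?_⟩
    calc (2 - p * qs p m) * (1 + p * As p m) ≤ 1 / p * (1 + p * As p m) := by
          apply mul_le_mul_of_nonneg_right hy; positivity
      _ = 1 / p + As p m := by field_simp
      _ ≤ 2 * ((m + 1 : ℕ) : ℝ) := by
          have : 1 / p ≤ 2 := by rw [div_le_iff₀ hp0]; linarith
          push_cast; linarith

lemma OPTA_le_s7 (d : ℕ) (hd : 1 ≤ d) (p : ℝ) (hp : 1 / 2 < p) (hp1 : p ≤ 1) :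
    OPTA (2 ^ (d + 1) - 2) (treeConn d) (fun _ => 1) (fun _ => p) ≤ 2 * d := by
  have hn : 0 < 2 ^ (d + 1) - 2 := by
    have : 2 ^ 2 ≤ 2 ^ (d + 1) := Nat.pow_le_pow_right (by norm_num) (by omega)
    omega
  have hE : adExpCost _ (fun _ => 1) (fun _ => p) (dfsTree d hn) = As p d := by
    rw [recE_eq p _ (dfsTree_readOnce d hn), dfsTree, dfs_recE]
    simp [recE]
  have hc : ∀ (t : DecTree (2 ^ (d + 1) - 2)) x, 0 ≤ t.costOn (fun _ => 1) x := by
    intro t x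
    induction t with
    | leaf b => exact le_rfl
    | node j t0 t1 h0 h1 => simp only [DecTree.costOn]; split_ifs <;> linarith
  unfold OPTA
  have hbdd : BddBelow {r : ℝ | ∃ t : DecTree (2 ^ (d + 1) - 2), DecTree.Computes t (treeConn d) ∧
      r = adExpCost _ (fun _ => 1) (fun _ => p) t} := by
    refine ⟨0, ?_⟩
    rintro r ⟨t, -, rfl⟩
    exact Finset.sum_nonneg fun x _ =>
      mul_nonneg (prodWeight_nonneg _ p (by linarith) hp1 x) (hc t x)
  refine (csInf_le hbdd ⟨dfsTree d hn, dfsTree_computes d hn, rfl⟩).trans ?_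
  rw [hE]
  exact (As_bound p hp hp1 d).2

lemma prob_conn (d : ℕ) (hd : 1 ≤ d) (p : ℝ) (hp : 1 / 2 < p) (hp1 : p ≤ 1) :
    (2 * p - 1) / p ^ 2 ≤ ∑ x : Fin (2 ^ (d + 1) - 2) → Bool,
      prodWeight _ (fun _ => p) x * (if treeConn d x then 1 else 0) := by
  have hn : 0 < 2 ^ (d + 1) - 2 := by
    have : 2 ^ 2 ≤ 2 ^ (d + 1) := Nat.pow_le_pow_right (by norm_num) (by omega)
    omega
  have h := recP_eq p _ (dfsTree_readOnce d hn)
  simp only [dfsTree_computes d hn _] at h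
  rw [h, dfsTree, dfs_recP]
  simp [recP]
  exact (qs_bounds p hp hp1 d).1

/-! ### Leaves -/

lemma prob_leaf (d : ℕ) (hn : 0 < 2 ^ (d + 1) - 2) (p : ℝ) (v : ℕ) (h1 : 2 ^ d ≤ v)
    (h2 : v < 2 ^ (d + 1)) :
    ∑ x : Fin (2 ^ (d + 1) - 2) → Bool,
      prodWeight _ (fun _ => p) x * (if leafAlive d x v then 1 else 0) = p ^ d := by
  classical
  have hge : ∀ j < d, 2 ≤ v / 2 ^ j := by
    intro j hj
    rw [Nat.le_div_iff_mul_le (by positivity)]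
    calc 2 * 2 ^ j = 2 ^ (j + 1) := by ring
      _ ≤ 2 ^ d := Nat.pow_le_pow_right (by norm_num) hj
      _ ≤ v := h1
  have hlt : ∀ j, v / 2 ^ j < 2 ^ (d + 1) := fun j => (Nat.div_le_self _ _).trans_lt h2
  set S := (Finset.range d).image (fun j => eIdx hn (v / 2 ^ j)) with hS
  have hcard : S.card = d := by
    rw [hS, Finset.card_image_of_injOn, Finset.card_range]
    intro j hj k hk hjk
    have hj' : j < d := by simpa using hj
    have hk' : k < d := by simpa using hk
    have e1 := eIdx_val hn (hge j hj') (by have := hlt j; omega)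
    have e2 := eIdx_val hn (hge k hk') (by have := hlt k; omega)
    simp only at hjk
    rw [hjk] at e1
    have e3 : v / 2 ^ j = v / 2 ^ k := by omega
    have g1 := hge j hj'
    have g2 := hge k hk'
    rcases lt_trichotomy j k with h | h | h
    · have := div_pow_cmp (w := v) rfl rfl h; omega
    · exact h
    · have := div_pow_cmp (w := v) rfl rfl h; omega
  have := sum_all_true p S
  rw [hcard] at this
  rw [← this]
  apply Finset.sum_congr rfl
  intro x _
  have : leafAlive d x v = true ↔ ∀ i ∈ S, x i = true := by
    simp only [leafAlive, decide_eq_true_eq, hS, Finset.mem_image, Finset.mem_range]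
    constructor
    · rintro h i ⟨j, hj, rfl⟩
      rw [← edgeVal_eq d hn x _ (hge j hj) (hlt j)]
      exact h j hj
    · intro h j hj
      rw [edgeVal_eq d hn x _ (hge j hj) (hlt j)]
      exact h _ ⟨j, hj, rfl⟩
  simp only [this]

lemma leaf_of_determines (d : ℕ) (hd : 1 ≤ d) (hn : 0 < 2 ^ (d + 1) - 2)
    (T : Finset (Fin (2 ^ (d + 1) - 2)))
    (x : Fin (2 ^ (d + 1) - 2) → Bool) (hT : Determines _ (treeConn d) T x)
    (hx : treeConn d x = true) :
    ∃ i ∈ T, 2 ^ d ≤ i.val + 2 ∧ leafAlive d x (i.val + 2) = true := by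
  classical
  have h := hT (fun i => if i ∈ T then x i else false) (fun i hi => by simp [hi])
  rw [hx] at h
  simp only [treeConn, leafAlive, decide_eq_true_eq, Finset.mem_Ico, Finset.mem_range] at h
  obtain ⟨v, ⟨h1, h2⟩, h⟩ := h
  have hv2 : 2 ≤ v := by
    have : 2 ^ 1 ≤ 2 ^ d := Nat.pow_le_pow_right (by norm_num) hd
    omega
  have key : ∀ w, edgeVal d (fun i => if i ∈ T then x i else false) w = true →
      edgeVal d x w = true ∧ ∃ hw : w - 2 < 2 ^ (d + 1) - 2, (⟨w - 2, hw⟩ : Fin _) ∈ T := by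
    intro w hw
    unfold edgeVal at hw ⊢
    by_cases a : w - 2 < 2 ^ (d + 1) - 2
    · rw [dif_pos a] at hw ⊢
      by_cases b : (⟨w - 2, a⟩ : Fin _) ∈ T
      · simp only [b, if_true] at hw
        exact ⟨hw, a, b⟩
      · simp [b] at hw
    · simp [a] at hw
  obtain ⟨-, hw, hm⟩ := key v (by simpa using h 0 hd)
  have hvv : v - 2 + 2 = v := by omega
  refine ⟨_, hm, ?_, ?_⟩
  · simp only; omega
  · simp only [hvv, leafAlive, decide_eq_true_eq, Finset.mem_range]
    exact fun j hj => (key _ (h j hj)).1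

/-! ### Non-adaptive strategies -/

lemma card_prefixSet (n : ℕ) (π : Equiv.Perm (Fin n)) (k : ℕ) :
    (prefixSet n π k).card = min k n := by
  classical
  have : prefixSet n π k = (Finset.univ.filter (fun i : Fin n => i.val < k)).map π.toEmbedding := by
    ext i
    simp only [prefixSet, Finset.mem_filter, Finset.mem_univ, true_and, Finset.mem_map,
      Equiv.coe_toEmbedding]
    constructor
    · intro h; exact ⟨_, h, by simp⟩
    · rintro ⟨a, h, rfl⟩; simpa using h
  rw [this, Finset.card_map, Fin.card_filter_val_lt, min_comm]

lemma naSteps_spec (n : ℕ) (f : (Fin n → Bool) → Bool) (π : Equiv.Perm (Fin n))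
    (x : Fin n → Bool) :
    Determines n f (prefixSet n π (naSteps n f π x)) x ∧ naSteps n f π x ≤ n := by
  have hne : n ∈ {k : ℕ | Determines n f (prefixSet n π k) x} := by
    intro x' h
    congr 1
    funext i
    exact h i (by simp [prefixSet])
  exact ⟨Nat.sInf_mem ⟨n, hne⟩, Nat.sInf_le hne⟩

lemma naCost_eq (n : ℕ) (f : (Fin n → Bool) → Bool) (π : Equiv.Perm (Fin n))
    (x : Fin n → Bool) : naCost n f (fun _ => 1) π x = naSteps n f π x := by
  unfold naCost
  rw [Finset.sum_const, card_prefixSet, min_eq_left (naSteps_spec n f π x).2]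
  simp

lemma naExp_ge (d : ℕ) (hd : 1 ≤ d) (p : ℝ) (hp : 1 / 2 < p) (hp1 : p ≤ 1) (t : ℝ) (ht : 0 ≤ t)
    (π : Equiv.Perm (Fin (2 ^ (d + 1) - 2))) :
    t * ((2 * p - 1) / p ^ 2 - t * p ^ d) ≤
      naExpCost _ (treeConn d) (fun _ => 1) (fun _ => p) π := by
  classical
  have hn : 0 < 2 ^ (d + 1) - 2 := by
    have : 2 ^ 2 ≤ 2 ^ (d + 1) := Nat.pow_le_pow_right (by norm_num) (by omega)
    omega
  set k := ⌊t⌋₊ with hk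
  set T := (prefixSet _ π k).filter (fun i => 2 ^ d ≤ i.val + 2) with hT
  have hTc : (T.card : ℝ) ≤ t := by
    have : T.card ≤ k := by
      refine (Finset.card_filter_le _ _).trans ?_
      rw [card_prefixSet]; exact min_le_left _ _
    exact (Nat.cast_le.2 this).trans (Nat.floor_le ht)
  have hW := prodWeight_nonneg (2 ^ (d + 1) - 2) p (by linarith) hp1
  have point : ∀ x, t * ((if treeConn d x then 1 else 0) -
      ∑ i ∈ T, (if leafAlive d x (i.val + 2) then 1 else 0)) ≤
      naCost _ (treeConn d) (fun _ => 1) π x := by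
    intro x
    rw [naCost_eq]
    have hS0 : ∀ i ∈ T, (0:ℝ) ≤ (if leafAlive d x (i.val + 2) then 1 else 0) := by
      intro i _; split_ifs <;> norm_num
    have hS := Finset.sum_nonneg hS0
    by_cases hc : treeConn d x = true
    · rw [if_pos hc]
      by_cases hs : naSteps _ (treeConn d) π x ≤ k
      · obtain ⟨i, hi, h1, h2⟩ := leaf_of_determines d hd hn _ x (naSteps_spec _ _ π x).1 hc
        have hiT : i ∈ T := by
          rw [hT, Finset.mem_filter]
          refine ⟨?_, h1⟩
          simp only [prefixSet, Finset.mem_filter, Finset.mem_univ, true_and] at hi ⊢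
          omega
        have := Finset.single_le_sum hS0 hiT
        rw [if_pos h2] at this
        have h0 : (0:ℝ) ≤ (naSteps _ (treeConn d) π x : ℝ) := Nat.cast_nonneg _
        nlinarith
      · have h1 : t < (naSteps _ (treeConn d) π x : ℝ) := by
          apply (Nat.floor_lt ht).1; omega
        nlinarith
    · rw [if_neg hc]
      have h0 : (0:ℝ) ≤ (naSteps _ (treeConn d) π x : ℝ) := Nat.cast_nonneg _
      nlinarith
  have hsum : ∑ x : Fin (2 ^ (d + 1) - 2) → Bool, prodWeight _ (fun _ => p) x *
      (t * ((if treeConn d x then 1 else 0) -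
      ∑ i ∈ T, (if leafAlive d x (i.val + 2) then 1 else 0))) ≤
      naExpCost _ (treeConn d) (fun _ => 1) (fun _ => p) π :=
    Finset.sum_le_sum fun x _ => mul_le_mul_of_nonneg_left (point x) (hW x)
  refine le_trans ?_ hsum
  have e : ∑ x : Fin (2 ^ (d + 1) - 2) → Bool, prodWeight _ (fun _ => p) x *
      (t * ((if treeConn d x then 1 else 0) -
      ∑ i ∈ T, (if leafAlive d x (i.val + 2) then 1 else 0)))
      = t * (∑ x : Fin (2 ^ (d + 1) - 2) → Bool,
      prodWeight _ (fun _ => p) x * (if treeConn d x then 1 else 0) - T.card * p ^ d) := by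
    have e2 : (T.card : ℝ) * p ^ d = ∑ x : Fin (2 ^ (d + 1) - 2) → Bool,
        prodWeight _ (fun _ => p) x * ∑ i ∈ T, (if leafAlive d x (i.val + 2) then 1 else 0) := by
      simp_rw [Finset.mul_sum]
      rw [Finset.sum_comm, ← nsmul_eq_mul, ← Finset.sum_const]
      apply Finset.sum_congr rfl
      intro i hi
      rw [prob_leaf d hn p _ (Finset.mem_filter.1 hi).2 (by have := i.2; omega)]
    rw [e2, ← Finset.sum_sub_distrib, Finset.mul_sum]
    apply Finset.sum_congr rfl
    intro x _
    ring
  rw [e]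
  apply mul_le_mul_of_nonneg_left _ ht
  have h1 := prob_conn d hd p hp hp1
  have h2 : (T.card : ℝ) * p ^ d ≤ t * p ^ d :=
    mul_le_mul_of_nonneg_right hTc (by positivity)
  linarith

lemma OPTN_ge (d : ℕ) (hd : 1 ≤ d) (ε : ℝ) (h0 : 0 < ε) (h1 : ε ≤ 1 / 2) :
    ε ^ 2 / 2 * (2 ^ d * Real.exp (-(ε * d))) ≤
      OPTN (2 ^ (d + 1) - 2) (treeConn d) (fun _ => 1) (fun _ => (1 + ε) / 2) := by
  refine le_csInf ⟨_, Equiv.refl _, rfl⟩ ?_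
  rintro r ⟨π, rfl⟩
  set p := (1 + ε) / 2 with hp
  have hp0 : 0 < p := by positivity
  have key := naExp_ge d hd p (by linarith) (by linarith) (ε / p ^ d) (by positivity) π
  refine le_trans ?_ key
  have e1 : ε / p ^ d * p ^ d = ε := by field_simp
  rw [e1]
  have e2 : 3 / 2 * ε ≤ (2 * p - 1) / p ^ 2 := by
    rw [le_div_iff₀ (by positivity), hp]
    nlinarith [mul_nonneg h0.le (sub_nonneg.2 h1), mul_nonneg (mul_nonneg h0.le h0.le) (sub_nonneg.2 h1)]
  have e3 : 2 ^ d * Real.exp (-(ε * d)) ≤ 1 / p ^ d := by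
    have : (1 + ε) ^ d ≤ Real.exp (ε * d) := by
      rw [mul_comm, Real.exp_nat_mul]
      apply pow_le_pow_left₀ (by positivity)
      linarith [Real.add_one_le_exp ε]
    rw [Real.exp_neg, hp, div_pow, one_div_div, ← div_eq_mul_inv]
    exact div_le_div_of_nonneg_left (by positivity) (by positivity) this
  calc ε ^ 2 / 2 * (2 ^ d * Real.exp (-(ε * d))) ≤ ε ^ 2 / 2 * (1 / p ^ d) :=
        mul_le_mul_of_nonneg_left e3 (by positivity)
    _ = ε / p ^ d * (ε / 2) := by ring
    _ ≤ _ := mul_le_mul_of_nonneg_left (by linarith) (by positivity)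

lemma rpow_bound (d : ℕ) (hd : 1 ≤ d) (ε : ℝ) (h0 : 0 < ε) :
    ((2 ^ (d + 1) - 2 : ℕ) : ℝ) ^ (1 - 2 * ε / Real.log 2) ≤
      2 * 2 ^ d * (Real.exp (-(ε * d)) * Real.exp (-(ε * d))) := by
  have hl : 0 < Real.log 2 := Real.log_pos (by norm_num)
  have hN : 2 ^ d ≤ 2 ^ (d + 1) - 2 ∧ 2 ^ (d + 1) - 2 ≤ 2 * 2 ^ d := by
    have : 2 ^ 1 ≤ 2 ^ d := Nat.pow_le_pow_right (by norm_num) hd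
    have := pow_succ 2 d
    omega
  obtain ⟨a, b⟩ := hN
  generalize 2 ^ (d + 1) - 2 = N at a b
  have a' : (2:ℝ) ^ d ≤ N := by exact_mod_cast a
  have b' : (N:ℝ) ≤ 2 * 2 ^ d := by exact_mod_cast b
  have hNp : (0:ℝ) < N := lt_of_lt_of_le (by positivity) a'
  rw [sub_eq_add_neg, Real.rpow_add hNp, Real.rpow_one]
  have h2 : (N:ℝ) ^ (-(2 * ε / Real.log 2)) ≤ Real.exp (-(ε * d)) * Real.exp (-(ε * d)) := by
    calc (N:ℝ) ^ (-(2 * ε / Real.log 2)) ≤ ((2:ℝ) ^ d) ^ (-(2 * ε / Real.log 2)) :=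
          Real.rpow_le_rpow_of_nonpos (by positivity) a' (by
            have : 0 < 2 * ε / Real.log 2 := by positivity
            linarith)
      _ = _ := by
          rw [Real.rpow_def_of_pos (by positivity), Real.log_pow, ← Real.exp_add]
          congr 1
          field_simp
          ring
  exact mul_le_mul b' h2 (by positivity) (by positivity)

/-- There is a constant `K > 0` such that for every `ε ∈ (0, 1/2]` and every integer
`d ≥ 1`, with `n = 2^(d+1) - 2` and `f` the tree-connectivity function of the complete
rooted binary tree of depth `d`, under unit costs and probabilities `p_i = (1+ε)/2`,
`OPT_N(f) ≥ K·ε³·n^{1 - 2ε/ln 2}·OPT_A(f)`. -/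
theorem stmt7 :
    ∃ K : ℝ, 0 < K ∧
      ∀ ε : ℝ, 0 < ε → ε ≤ 1/2 →
        ∀ d : ℕ, 1 ≤ d →
          K * ε ^ 3 * ((2 ^ (d + 1) - 2 : ℕ) : ℝ) ^ (1 - 2 * ε / Real.log 2) *
              OPTA (2 ^ (d + 1) - 2) (treeConn d) (fun _ => 1) (fun _ => (1 + ε) / 2) ≤
            OPTN (2 ^ (d + 1) - 2) (treeConn d) (fun _ => 1) (fun _ => (1 + ε) / 2) := by
  refine ⟨1 / 8, by norm_num, ?_⟩
  intro ε h0 h1 d hd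
  refine le_trans ?_ (OPTN_ge d hd ε h0 h1)
  have hA := OPTA_le_s7 d hd ((1 + ε) / 2) (by linarith) (by linarith)
  have hr := rpow_bound d hd ε h0
  have hr0 : (0:ℝ) ≤ ((2 ^ (d + 1) - 2 : ℕ) : ℝ) ^ (1 - 2 * ε / Real.log 2) :=
    Real.rpow_nonneg (Nat.cast_nonneg _) _
  have hx : ε * d * Real.exp (-(ε * d)) ≤ 1 := by
    rw [Real.exp_neg, ← div_eq_mul_inv, div_le_one (Real.exp_pos _)]
    linarith [Real.add_one_le_exp (ε * d)]
  set E := Real.exp (-(ε * d)) with hE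
  have hE0 : 0 < E := Real.exp_pos _
  calc _ ≤ 1 / 8 * ε ^ 3 * ((2 ^ (d + 1) - 2 : ℕ) : ℝ) ^ (1 - 2 * ε / Real.log 2) * (2 * d) :=
        mul_le_mul_of_nonneg_left hA (by positivity)
    _ ≤ 1 / 8 * ε ^ 3 * (2 * 2 ^ d * (E * E)) * (2 * d) := by gcongr
    _ = ε ^ 2 / 2 * (2 ^ d * E) * (ε * d * E) := by ring
    _ ≤ ε ^ 2 / 2 * (2 ^ d * E) * 1 := mul_le_mul_of_nonneg_left hx (by positivity)
    _ = _ := by ring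
end
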